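/- Let k be a number field of degree n over ℚ and let L be a quadratic extension of k. There exist a constant c > 0 and V₀ (depending on k and L) such that for all V ≥ V₀: the number of squarefree nonzero ideals 𝔡 of 𝓞_k satisfying |𝔡| ≤ V, such that no prime ideal divisor of 𝔡 splits in L, and such that the number of distinct prime ideal divisors of 𝔡 is congruent to n − 1 modulo 2, is at least c·V·(log V)^{-1/2}. -/

import Mathlib

open NumberField

/-- A nonzero prime ideal `P` of `𝓞 k` splits in the extension `L/k` if there are two distinct
(nonzero) prime ideals of `𝓞 L` lying above `P`. -/
def SplitsIn (k L : Type*) [Field k] [NumberField k] [Field L] [NumberField L]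
    [Algebra k L] (P : Ideal (𝓞 k)) : Prop :=
  ∃ Q₁ Q₂ : Ideal (𝓞 L), Q₁ ≠ Q₂ ∧ Q₁.IsPrime ∧ Q₂.IsPrime ∧ Q₁ ≠ ⊥ ∧ Q₂ ≠ ⊥ ∧
    Q₁.comap (algebraMap (𝓞 k) (𝓞 L)) = P ∧ Q₂.comap (algebraMap (𝓞 k) (𝓞 L)) = P

section Auxiliary

open Filter Topology Finset

section General

variable (K : Type*) [Field K] [NumberField K]

/-- The nonzero ideals of `𝓞 K` of norm at most `N`. -/
noncomputable def idealsLE (N : ℕ) : Finset (Ideal (𝓞 K)) :=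
  ((Ideal.finite_setOfPred_absNorm_le N).subset
    (fun I (hI : I ≠ ⊥ ∧ Ideal.absNorm I ≤ N) => hI.2) :
    {I : Ideal (𝓞 K) | I ≠ ⊥ ∧ Ideal.absNorm I ≤ N}.Finite).toFinset

variable {K}

@[simp] lemma mem_idealsLE {N : ℕ} {I : Ideal (𝓞 K)} :
    I ∈ idealsLE K N ↔ I ≠ ⊥ ∧ Ideal.absNorm I ≤ N := by
  simp [idealsLE]

lemma one_le_absNorm {I : Ideal (𝓞 K)} (hI : I ≠ ⊥) : 1 ≤ Ideal.absNorm I :=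
  Nat.one_le_iff_ne_zero.mpr (mt Ideal.absNorm_eq_zero_iff.mp hI)

lemma absNorm_cast_pos {I : Ideal (𝓞 K)} (hI : I ≠ ⊥) : (0 : ℝ) < Ideal.absNorm I :=
  Nat.cast_pos.mpr (one_le_absNorm hI)

variable (K) in
lemma tendsto_card_idealsLE_div :
    Tendsto (fun N : ℕ => (#(idealsLE K N) : ℝ) / N) atTop (𝓝 (dedekindZeta_residue K)) := by
  refine ((Ideal.tendsto_norm_le_div_atTop₀ K).comp tendsto_natCast_atTop_atTop).congr fun N => ?_
  simp only [Function.comp_apply, Nat.cast_le]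
  congr 2
  rw [← Nat.card_eq_finsetCard]
  refine Nat.card_congr ⟨fun I => ⟨I.1.1, mem_idealsLE.mpr ⟨nonZeroDivisors.ne_zero I.1.2, I.2⟩⟩,
    fun I => ⟨⟨I.1, mem_nonZeroDivisors_of_ne_zero (mem_idealsLE.mp I.2).1⟩,
      (mem_idealsLE.mp I.2).2⟩, fun _ => rfl, fun _ => rfl⟩

variable (K) in
lemma exists_card_idealsLE_le : ∃ C : ℝ, 0 < C ∧ ∀ N : ℕ, (#(idealsLE K N) : ℝ) ≤ C * N := by
  obtain ⟨C, hC⟩ := (tendsto_card_idealsLE_div K).bddAbove_range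
  refine ⟨max C 1, by positivity, fun N => ?_⟩
  rcases Nat.eq_zero_or_pos N with rfl | hN
  · have : idealsLE K 0 = ∅ := by
      ext I
      simp only [mem_idealsLE, Finset.notMem_empty, iff_false, not_and, not_le]
      exact fun h => one_le_absNorm h
    simp [this]
  · have := hC ⟨N, rfl⟩
    simp only at this
    rw [div_le_iff₀ (by positivity)] at this
    exact this.trans (by gcongr; exact le_max_left _ _)

variable (K) in
lemma exists_le_card_idealsLE : ∃ c : ℝ, 0 < c ∧ ∃ N₀ : ℕ, ∀ N ≥ N₀,
    c * N ≤ (#(idealsLE K N) : ℝ) := by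
  have h0 := dedekindZeta_residue_pos K
  refine ⟨dedekindZeta_residue K / 2, by positivity, ?_⟩
  obtain ⟨N₀, h⟩ := eventually_atTop.mp
    ((tendsto_card_idealsLE_div K).eventually (lt_mem_nhds (half_lt_self h0)))
  refine ⟨N₀ + 1, fun N hN => ?_⟩
  have hN0 : (0 : ℝ) < N := by exact_mod_cast (show 0 < N by omega)
  have := h N (by omega)
  rw [lt_div_iff₀ hN0] at this
  exact this.le

lemma sum_inv_eq_sum_card_div {α : Type*} (s : Finset α) (m : α → ℕ) (N : ℕ)
    (h1 : ∀ a ∈ s, 1 ≤ m a) (h2 : ∀ a ∈ s, m a ≤ N) :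
    ∑ a ∈ s, (m a : ℝ)⁻¹ =
      ∑ k ∈ Icc 1 N, (#{a ∈ s | m a ≤ k} : ℝ) / (k * (k + 1)) + #s / (N + 1 : ℝ) := by
  have key : ∀ a ∈ s, (m a : ℝ)⁻¹ =
      ∑ k ∈ Icc 1 N, (if m a ≤ k then (1 : ℝ) / (k * (k + 1)) else 0) + 1 / (N + 1 : ℝ) := by
    intro a ha
    have h1 := h1 a ha
    have h2 := h2 a ha
    rw [← Finset.sum_filter]
    have : (Icc 1 N).filter (fun k => m a ≤ k) = Ico (m a) (N + 1) := by
      ext k; simp; omega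
    rw [this]
    clear this
    have h3 : ∀ n, m a ≤ n → ∑ k ∈ Ico (m a) n, (1 : ℝ) / (k * (k + 1)) =
        (m a : ℝ)⁻¹ - (n : ℝ)⁻¹ := by
      intro n hn
      induction n, hn using Nat.le_induction with
      | base => simp
      | succ n hn ih =>
        have hn0 : (n : ℝ) ≠ 0 := by
          have : 0 < n := by omega
          positivity
        rw [Finset.sum_Ico_succ_top hn, ih]
        push_cast
        field_simp
        ring
    rw [h3 _ (by omega)]
    push_cast
    simp
  rw [Finset.sum_congr rfl key, Finset.sum_add_distrib, Finset.sum_comm]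
  congr 1
  · refine Finset.sum_congr rfl fun k _ => ?_
    rw [← Finset.sum_filter, Finset.sum_const, nsmul_eq_mul, mul_one_div]
  · rw [Finset.sum_const, nsmul_eq_mul, mul_one_div]

lemma filter_idealsLE {N k : ℕ} (hk : k ≤ N) :
    (idealsLE K N).filter (fun I => Ideal.absNorm I ≤ k) = idealsLE K k := by
  ext I
  simp only [Finset.mem_filter, mem_idealsLE]
  constructor
  · rintro ⟨⟨h, -⟩, h'⟩; exact ⟨h, h'⟩
  · rintro ⟨h, h'⟩; exact ⟨⟨h, h'.trans hk⟩, h'⟩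

lemma sum_inv_absNorm_eq (N : ℕ) :
    ∑ I ∈ idealsLE K N, (Ideal.absNorm I : ℝ)⁻¹ =
      ∑ k ∈ Icc 1 N, (#(idealsLE K k) : ℝ) / (k * (k + 1)) + #(idealsLE K N) / (N + 1 : ℝ) := by
  rw [sum_inv_eq_sum_card_div (idealsLE K N) (fun I => Ideal.absNorm I) N
    (fun I hI => one_le_absNorm (mem_idealsLE.mp hI).1) (fun I hI => (mem_idealsLE.mp hI).2)]
  congr 1
  refine Finset.sum_congr rfl fun k hk => ?_
  rw [filter_idealsLE (Finset.mem_Icc.mp hk).2]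

variable (K) in
lemma exists_sum_inv_absNorm_le : ∃ C : ℝ, 0 < C ∧ ∀ N : ℕ, 1 ≤ N →
    ∑ I ∈ idealsLE K N, (Ideal.absNorm I : ℝ)⁻¹ ≤ C * (1 + Real.log N) := by
  obtain ⟨C, hC, h⟩ := exists_card_idealsLE_le K
  refine ⟨2 * C, by positivity, fun N hN => ?_⟩
  rw [sum_inv_absNorm_eq]
  have hlog : 0 ≤ Real.log N := Real.log_natCast_nonneg N
  have h1 : ∑ k ∈ Icc 1 N, (#(idealsLE K k) : ℝ) / (k * (k + 1)) ≤ C * (1 + Real.log N) := by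
    calc _ ≤ ∑ k ∈ Icc 1 N, C * (k : ℝ)⁻¹ := by
          refine Finset.sum_le_sum fun k hk => ?_
          have hk0 : (0 : ℝ) < k := by exact_mod_cast (Finset.mem_Icc.mp hk).1
          rw [div_le_iff₀ (by positivity)]
          refine (h k).trans ?_
          field_simp
          nlinarith
      _ ≤ _ := by
          rw [← Finset.mul_sum]
          gcongr
          have := harmonic_le_one_add_log N
          rw [harmonic_eq_sum_Icc] at this
          push_cast at this
          exact this
  have h2 : (#(idealsLE K N) : ℝ) / (N + 1 : ℝ) ≤ C := by
    rw [div_le_iff₀ (by positivity)]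
    nlinarith [h N]
  nlinarith

variable (K) in
lemma exists_le_sum_inv_absNorm : ∃ c : ℝ, 0 < c ∧ ∃ C : ℝ, ∀ N : ℕ, 1 ≤ N →
    c * Real.log N - C ≤ ∑ I ∈ idealsLE K N, (Ideal.absNorm I : ℝ)⁻¹ := by
  obtain ⟨c, hc, N₀, h⟩ := exists_le_card_idealsLE K
  refine ⟨c, hc, c * (N₀ + 1), fun N hN => ?_⟩
  rw [sum_inv_absNorm_eq]
  have h1 : ∑ k ∈ Icc 1 N, (c * ((k + 1 : ℕ) : ℝ)⁻¹ - if k ≤ N₀ then c else 0) ≤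
      ∑ k ∈ Icc 1 N, (#(idealsLE K k) : ℝ) / (k * (k + 1)) := by
    refine Finset.sum_le_sum fun k hk => ?_
    have hk0 : (0 : ℝ) < k := by exact_mod_cast (Finset.mem_Icc.mp hk).1
    split_ifs with h'
    · refine le_trans ?_ (show (0 : ℝ) ≤ _ by positivity)
      rw [sub_nonpos]
      exact mul_le_of_le_one_right hc.le (inv_le_one_of_one_le₀ (by exact_mod_cast k.succ_pos))
    · rw [sub_zero, le_div_iff₀ (by positivity)]
      refine le_trans (le_of_eq ?_) (h k (by omega))
      push_cast
      field_simp
  have h2 : c * Real.log N ≤ c * ∑ k ∈ Icc 1 (N + 1), (k : ℝ)⁻¹ := by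
    gcongr
    have := log_add_one_le_harmonic (N + 1)
    rw [harmonic_eq_sum_Icc] at this
    push_cast at this
    refine le_trans (Real.log_le_log (by positivity) ?_) this
    linarith
  have h3 : ∀ N : ℕ, ∑ k ∈ Icc 1 (N + 1), (k : ℝ)⁻¹ = 1 + ∑ k ∈ Icc 1 N, ((k + 1 : ℕ) : ℝ)⁻¹ := by
    intro N
    induction N with
    | zero => simp
    | succ N ih =>
      rw [Finset.sum_Icc_succ_top (by omega), ih, Finset.sum_Icc_succ_top (by omega)]
      ring
  have h4 : ∑ k ∈ Icc 1 N, (if k ≤ N₀ then c else 0) ≤ c * N₀ := by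
    rw [← Finset.sum_filter, Finset.sum_const, nsmul_eq_mul, mul_comm]
    gcongr
    calc _ ≤ #(Icc 1 N₀) := Finset.card_le_card fun k => by simp; omega
      _ = N₀ := by simp
  have h5 : 0 ≤ (#(idealsLE K N) : ℝ) / (N + 1 : ℝ) := by positivity
  rw [Finset.sum_sub_distrib, ← Finset.mul_sum] at h1
  rw [h3, mul_add] at h2
  linarith

variable (K) in
lemma exists_sum_rpow_absNorm_le : ∃ C : ℝ, 0 < C ∧ ∀ N : ℕ,
    ∑ I ∈ idealsLE K N, (Ideal.absNorm I : ℝ) ^ (-(3 / 2) : ℝ) ≤ C := by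
  obtain ⟨C, hC, h⟩ := exists_card_idealsLE_le K
  have hs : Summable fun k : ℕ => (k : ℝ) ^ (-(3 / 2) : ℝ) :=
    Real.summable_nat_rpow.mpr (by norm_num)
  set D : ℝ := (2 : ℝ) ^ (5 / 2 : ℝ) with hD
  have hD0 : 0 < D := by positivity
  have hpos : 0 ≤ ∑' k : ℕ, (k : ℝ) ^ (-(3 / 2) : ℝ) := tsum_nonneg fun k => by positivity
  refine ⟨D * (C * ∑' k : ℕ, (k : ℝ) ^ (-(3 / 2) : ℝ)) + 1, by positivity, fun N => ?_⟩
  have key : ∀ I ∈ idealsLE K N, (Ideal.absNorm I : ℝ) ^ (-(3 / 2) : ℝ) ≤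
      D * ∑ k ∈ Icc 1 (2 * N), if Ideal.absNorm I ≤ k then (k : ℝ) ^ (-(5 / 2) : ℝ) else 0 := by
    intro I hI
    rw [mem_idealsLE] at hI
    set m := Ideal.absNorm I
    have hm1 : 1 ≤ m := one_le_absNorm hI.1
    have hm0 : (0 : ℝ) < m := by exact_mod_cast hm1
    have h1 : ∑ k ∈ Ico m (2 * m), ((2 * m : ℕ) : ℝ) ^ (-(5 / 2) : ℝ) ≤
        ∑ k ∈ Icc 1 (2 * N), if m ≤ k then (k : ℝ) ^ (-(5 / 2) : ℝ) else 0 := by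
      rw [← Finset.sum_filter]
      refine (Finset.sum_le_sum fun k hk => ?_).trans
        (Finset.sum_le_sum_of_subset_of_nonneg (t := (Icc 1 (2 * N)).filter (m ≤ ·)) ?_ ?_)
      · rw [Finset.mem_Ico] at hk
        have : (0 : ℝ) < k := by exact_mod_cast (show 0 < k by omega)
        exact Real.rpow_le_rpow_of_nonpos this (by exact_mod_cast hk.2.le) (by norm_num)
      · intro k; simp; omega
      · intro k _ _; positivity
    refine le_trans (le_of_eq ?_) (mul_le_mul_of_nonneg_left h1 hD0.le)
    rw [Finset.sum_const, Nat.card_Ico, nsmul_eq_mul, show 2 * m - m = m by omega]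
    push_cast
    rw [Real.mul_rpow (by norm_num) hm0.le, hD, Real.rpow_neg (by norm_num : (0 : ℝ) ≤ 2)]
    have : (m : ℝ) ^ (-(3 / 2) : ℝ) = m * (m : ℝ) ^ (-(5 / 2) : ℝ) := by
      nth_rewrite 2 [← Real.rpow_one (m : ℝ)]
      rw [← Real.rpow_add hm0]
      norm_num
    rw [this]
    field_simp
  calc _ ≤ _ := Finset.sum_le_sum key
    _ = D * ∑ k ∈ Icc 1 (2 * N), (#{I ∈ idealsLE K N | Ideal.absNorm I ≤ k} : ℝ) *
          (k : ℝ) ^ (-(5 / 2) : ℝ) := by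
        rw [← Finset.mul_sum, Finset.sum_comm]
        congr 1
        refine Finset.sum_congr rfl fun k _ => ?_
        rw [← Finset.sum_filter, Finset.sum_const, nsmul_eq_mul]
    _ ≤ D * ∑ k ∈ Icc 1 (2 * N), C * (k : ℝ) ^ (-(3 / 2) : ℝ) := by
        refine mul_le_mul_of_nonneg_left (Finset.sum_le_sum fun k hk => ?_) hD0.le
        have hk0 : (0 : ℝ) < k := by exact_mod_cast (Finset.mem_Icc.mp hk).1
        have h1 : (#{I ∈ idealsLE K N | Ideal.absNorm I ≤ k} : ℝ) ≤ C * k := by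
          refine le_trans ?_ (h k)
          exact_mod_cast Finset.card_le_card fun I => by
            simp only [Finset.mem_filter, mem_idealsLE]; tauto
        have : (k : ℝ) ^ (-(3 / 2) : ℝ) = k * (k : ℝ) ^ (-(5 / 2) : ℝ) := by
          nth_rewrite 2 [← Real.rpow_one (k : ℝ)]
          rw [← Real.rpow_add hk0]
          norm_num
        rw [this, ← mul_assoc]
        gcongr
    _ ≤ _ := by
        rw [← Finset.mul_sum]
        have := hs.sum_le_tsum (Icc 1 (2 * N)) fun k _ => by positivity
        have h2 : D * (C * ∑ k ∈ Icc 1 (2 * N), (k : ℝ) ^ (-(3 / 2) : ℝ)) ≤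
          D * (C * ∑' k : ℕ, (k : ℝ) ^ (-(3 / 2) : ℝ)) := by gcongr
        linarith

end General

section Chebyshev

variable (K : Type*) [Field K] [NumberField K]

open Classical in
/-- The pairs `(P, j)` with `P` a nonzero prime ideal, `1 ≤ j` and `|P| ^ j ≤ N`. -/
noncomputable def primePows (N : ℕ) : Finset (Ideal (𝓞 K) × ℕ) :=
  (idealsLE K N ×ˢ Icc 1 N).filter fun x => x.1.IsPrime ∧ Ideal.absNorm x.1 ^ x.2 ≤ N

variable {K}

lemma two_le_absNorm {P : Ideal (𝓞 K)} (hP : P.IsPrime) (h0 : P ≠ ⊥) : 2 ≤ Ideal.absNorm P := by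
  have h1 := one_le_absNorm h0
  have h2 : Ideal.absNorm P ≠ 1 := mt Ideal.absNorm_eq_one_iff.mp hP.ne_top
  omega

lemma mem_primePows {N : ℕ} {x : Ideal (𝓞 K) × ℕ} : x ∈ primePows K N ↔
    x.1 ≠ ⊥ ∧ x.1.IsPrime ∧ 1 ≤ x.2 ∧ Ideal.absNorm x.1 ^ x.2 ≤ N := by
  simp only [primePows, mem_filter, mem_product, mem_idealsLE, mem_Icc]
  refine ⟨fun h => ⟨h.1.1.1, h.2.1, h.1.2.1, h.2.2⟩, fun ⟨h1, h2, h3, h4⟩ => ?_⟩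
  have := two_le_absNorm h2 h1
  refine ⟨⟨⟨h1, (Nat.le_self_pow (by omega) _).trans h4⟩, h3, ?_⟩, h2, h4⟩
  exact ((Nat.lt_pow_self (by omega)).le).trans h4

lemma primePows_mono {M N : ℕ} (h : M ≤ N) : primePows K M ⊆ primePows K N := fun x hx => by
  rw [mem_primePows] at *
  exact ⟨hx.1, hx.2.1, hx.2.2.1, hx.2.2.2.trans h⟩

lemma log_absNorm_nonneg (P : Ideal (𝓞 K)) : 0 ≤ Real.log (Ideal.absNorm P) :=
  Real.log_natCast_nonneg _

lemma exists_absNorm_eq_prime_pow {P : Ideal (𝓞 K)} (hP : P.IsPrime) (h0 : P ≠ ⊥) :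
    ∃ p f : ℕ, p.Prime ∧ 1 ≤ f ∧ f ≤ Module.finrank ℚ K ∧ Ideal.absNorm P = p ^ f ∧
      (p : 𝓞 K) ∈ P := by
  obtain ⟨p, hp, hmem⟩ : ∃ p : ℕ, p.Prime ∧ (p : 𝓞 K) ∈ P := by
    have h1 := Ideal.absNorm_mem P
    rw [← Nat.prod_primeFactorsList (Nat.one_le_iff_ne_zero.mp (one_le_absNorm h0)),
      Nat.cast_list_prod, ← Multiset.prod_coe, hP.multiset_prod_mem_iff_exists_mem] at h1
    obtain ⟨q, hq, hqP⟩ := h1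
    obtain ⟨p, hp, rfl⟩ := List.mem_map.mp (Multiset.mem_coe.mp hq)
    exact ⟨p, Nat.prime_of_mem_primeFactorsList hp, hqP⟩
  have hdvd : Ideal.absNorm P ∣ p ^ Module.finrank ℚ K := by
    have := Ideal.absNorm_dvd_absNorm_of_le ((Ideal.span_singleton_le_iff_mem P).mpr hmem)
    rwa [Ideal.absNorm_span_natCast, RingOfIntegers.rank] at this
  obtain ⟨f, hf, hPf⟩ := (Nat.dvd_prime_pow hp).mp hdvd
  refine ⟨p, f, hp, ?_, hf, hPf, hmem⟩
  have := two_le_absNorm hP h0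
  rcases f.eq_zero_or_pos with rfl | h
  · rw [pow_zero] at hPf; omega
  · exact h

lemma card_primes_over_le {p : ℕ} (hp : p.Prime) (s : Finset (Ideal (𝓞 K)))
    (hs : ∀ P ∈ s, P.IsPrime ∧ P ≠ ⊥ ∧ (p : 𝓞 K) ∈ P) : #s ≤ Module.finrank ℚ K := by
  have hdvd : ∏ P ∈ s, P ∣ Ideal.span {(p : 𝓞 K)} :=
    Finset.prod_primes_dvd _ (fun P hP => Ideal.prime_of_isPrime (hs P hP).2.1 (hs P hP).1)
      fun P hP => Ideal.dvd_span_singleton.mpr (hs P hP).2.2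
  have h1 := map_dvd Ideal.absNorm hdvd
  rw [Ideal.absNorm_span_natCast, RingOfIntegers.rank, map_prod] at h1
  refine (Nat.pow_dvd_pow_iff_le_right hp.one_lt).mp (dvd_trans ?_ h1)
  rw [← Finset.prod_const]
  refine Finset.prod_dvd_prod_of_dvd _ _ fun P hP => ?_
  obtain ⟨q, f, hq, hf, -, hPf, hmem⟩ := exists_absNorm_eq_prime_pow (hs P hP).1 (hs P hP).2.1
  have hqp : q = p := by
    by_contra hne
    refine (hs P hP).1.ne_top ((Ideal.eq_top_iff_one _).mpr ?_)
    have hc : IsCoprime (q : ℤ) p :=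
      Nat.isCoprime_iff_coprime.mpr ((Nat.coprime_primes hq hp).mpr hne)
    obtain ⟨a, b, hab⟩ := hc
    have : (a : 𝓞 K) * q + b * p = 1 := mod_cast congrArg (Int.cast : ℤ → 𝓞 K) hab
    rw [← this]
    exact P.add_mem (P.mul_mem_left _ hmem) (P.mul_mem_left _ (hs P hP).2.2)
  rw [hPf, hqp]
  exact dvd_pow_self _ (by omega)

variable (K) in
/-- Chebyshev's upper bound for prime ideal powers. -/
lemma exists_sum_primePows_log_le : ∃ C : ℝ, 0 < C ∧ ∀ N : ℕ,
    ∑ x ∈ primePows K N, Real.log (Ideal.absNorm x.1) ≤ C * N := by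
  classical
  set n := Module.finrank ℚ K with hn
  have hn0 : 0 < n := Module.finrank_pos
  refine ⟨n * n * (Real.log 4 + 4), by have := Real.log_nonneg (x := 4) (by norm_num); positivity,
    fun N => ?_⟩
  have key : ∀ m ∈ Ioc 0 N, ∑ x ∈ primePows K N with Ideal.absNorm x.1 ^ x.2 = m,
      Real.log (Ideal.absNorm x.1) ≤ n * n * ArithmeticFunction.vonMangoldt m := by
    intro m hm
    set s := (primePows K N).filter fun x => Ideal.absNorm x.1 ^ x.2 = m with hs
    have hs' : ∀ x ∈ s, x.1 ≠ ⊥ ∧ x.1.IsPrime ∧ 1 ≤ x.2 ∧ Ideal.absNorm x.1 ^ x.2 = m := by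
      intro x hx
      rw [hs, mem_filter, mem_primePows] at hx
      exact ⟨hx.1.1, hx.1.2.1, hx.1.2.2.1, hx.2⟩
    have hminFac : ∀ x ∈ s, ∃ f : ℕ, 1 ≤ f ∧ f ≤ n ∧ Ideal.absNorm x.1 = m.minFac ^ f ∧
        m.minFac.Prime ∧ (m.minFac : 𝓞 K) ∈ x.1 ∧
        ArithmeticFunction.vonMangoldt m = Real.log m.minFac := by
      intro x hx
      obtain ⟨h0, hP, hj, hm⟩ := hs' x hx
      obtain ⟨p, f, hp, hf1, hfn, hpf, hmem⟩ := exists_absNorm_eq_prime_pow hP h0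
      have : m.minFac = p := by
        rw [← hm, hpf, ← pow_mul]
        exact hp.pow_minFac (by positivity)
      refine ⟨f, hf1, hfn, by rw [this, hpf], by rwa [this], by rwa [this], ?_⟩
      rw [this, ← hm, hpf, ← pow_mul, ArithmeticFunction.vonMangoldt_apply_pow (by positivity),
        ArithmeticFunction.vonMangoldt_apply_prime hp]
    have h1 : ∀ x ∈ s, Real.log (Ideal.absNorm x.1) ≤ n * ArithmeticFunction.vonMangoldt m := by
      intro x hx
      obtain ⟨f, hf1, hfn, hpf, hp, hmem, hL⟩ := hminFac x hx
      rw [hL, hpf, Nat.cast_pow, Real.log_pow]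
      exact mul_le_mul_of_nonneg_right (by exact_mod_cast hfn) (Real.log_natCast_nonneg _)
    have h2 : (#s : ℝ) ≤ n := by
      rcases s.eq_empty_or_nonempty with h | ⟨x, hx⟩
      · simp [h]
      obtain ⟨f, hf1, hfn, hpf, hp, hmem, hL⟩ := hminFac x hx
      have hinj : Set.InjOn (Prod.fst : Ideal (𝓞 K) × ℕ → _) (s : Set (Ideal (𝓞 K) × ℕ)) := by
        intro x hx y hy hxy
        obtain ⟨h0, hP, hj, hm⟩ := hs' x hx
        obtain ⟨-, -, -, hm'⟩ := hs' y hy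
        refine Prod.ext hxy ?_
        have h3 := two_le_absNorm hP h0
        rw [← hm, ← show x.1 = y.1 from hxy] at hm'
        exact (Nat.pow_right_injective h3 hm').symm
      rw [← card_image_of_injOn hinj]
      refine mod_cast card_primes_over_le hp _ fun P hP => ?_
      obtain ⟨y, hy, rfl⟩ := mem_image.mp hP
      exact ⟨(hs' y hy).2.1, (hs' y hy).1, (hminFac y hy).choose_spec.2.2.2.2.1⟩
    calc _ ≤ #s • ((n : ℝ) * ArithmeticFunction.vonMangoldt m) := sum_le_card_nsmul _ _ _ h1
      _ ≤ _ := by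
        rw [nsmul_eq_mul, mul_assoc]
        exact mul_le_mul_of_nonneg_right h2
          (mul_nonneg (by positivity) ArithmeticFunction.vonMangoldt_nonneg)
  have hmaps : ∀ x ∈ primePows K N, Ideal.absNorm x.1 ^ x.2 ∈ Ioc 0 N := by
    intro x hx
    obtain ⟨h0, hP, hj, hm⟩ := mem_primePows.mp hx
    exact mem_Ioc.mpr ⟨Nat.pow_pos (one_le_absNorm h0), hm⟩
  rw [← sum_fiberwise_of_maps_to hmaps]
  refine (sum_le_sum key).trans ?_
  rw [← mul_sum, mul_assoc (_ * _ : ℝ) (_ + _) _]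
  refine mul_le_mul_of_nonneg_left ?_ (by positivity)
  have := Chebyshev.psi_le_const_mul_self (N.cast_nonneg (α := ℝ))
  rwa [Chebyshev.psi, Nat.floor_natCast] at this

end Chebyshev

section Box

variable {K : Type*} [Field K] {ι : Type*} [Fintype ι] (b : Module.Basis ι ℤ (𝓞 K))

lemma exists_mul_repr_le : ∃ C : ℕ, ∀ x y : 𝓞 K, ∀ R S : ℕ, (∀ i, |b.repr x i| ≤ R) →
    (∀ i, |b.repr y i| ≤ S) → ∀ i, |b.repr (x * y) i| ≤ C * R * S := by
  refine ⟨∑ i, ∑ j, ∑ k, (b.repr (b i * b j) k).natAbs, fun x y R S hx hy k => ?_⟩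
  have h1 : x * y = ∑ i, ∑ j, (b.repr x i * b.repr y j) • (b i * b j) := by
    conv_lhs => rw [← b.sum_repr x, ← b.sum_repr y]
    rw [sum_mul_sum]
    refine sum_congr rfl fun i _ => sum_congr rfl fun j _ => ?_
    rw [smul_mul_smul_comm]
  rw [h1, map_sum, Finsupp.finsetSum_apply]
  simp only [map_sum, map_smul, Finsupp.finsetSum_apply, Finsupp.smul_apply, smul_eq_mul]
  push_cast
  rw [mul_assoc, sum_mul]
  refine (abs_sum_le_sum_abs _ _).trans (sum_le_sum fun i _ => ?_)
  rw [sum_mul]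
  refine (abs_sum_le_sum_abs _ _).trans (sum_le_sum fun j _ => ?_)
  rw [abs_mul, abs_mul, mul_comm]
  refine mul_le_mul ?_ ?_ (by positivity) (by positivity)
  · exact single_le_sum (f := fun k => |b.repr (b i * b j) k|) (fun _ _ => abs_nonneg _)
      (mem_univ k)
  · exact mul_le_mul (hx i) (hy j) (abs_nonneg _) (by positivity)

variable [DecidableEq ι]

/-- The lattice points in the box with lower corner `s` and side lengths `t`. -/
noncomputable def coordBox (s : ι → ℤ) (t : ι → ℕ) : Finset (𝓞 K) :=
  (Fintype.piFinset fun i => Ico (s i) (s i + t i)).map b.equivFun.symm.toEquiv.toEmbedding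

variable {b}

lemma mem_coordBox {s : ι → ℤ} {t : ι → ℕ} {x : 𝓞 K} :
    x ∈ coordBox b s t ↔ ∀ i, s i ≤ b.repr x i ∧ b.repr x i < s i + t i := by
  simp only [coordBox, mem_map_equiv, Fintype.mem_piFinset, mem_Ico]
  rfl

variable (b)

lemma card_coordBox (s : ι → ℤ) (t : ι → ℕ) : #(coordBox b s t) = ∏ i, t i := by
  simp [coordBox]

variable [NumberField K]

open Classical in
lemma card_coordBox_filter_le {𝔞 : Ideal (𝓞 K)} {ℓ : ℝ} (hℓ : 0 < ℓ)
    (h : ClassGroup.normBound AbsoluteValue.abs b * ℓ ^ Fintype.card ι ≤ Ideal.absNorm 𝔞)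
    (s : ι → ℤ) (t : ι → ℕ) :
    (#((coordBox b s t).filter (· ∈ 𝔞)) : ℝ) ≤ ∏ i, (t i / ℓ + 1) := by
  have key : #((coordBox b s t).filter (· ∈ 𝔞)) ≤
      #(Fintype.piFinset fun i => range (⌊t i / ℓ⌋₊ + 1)) := by
    refine card_le_card_of_injOn (fun x i => ⌊(b.repr x i - s i : ℤ) / ℓ⌋₊) ?_ ?_
    · intro x hx
      rw [mem_coe, mem_filter, mem_coordBox] at hx
      simp only [mem_coe, Fintype.mem_piFinset, mem_range]
      intro i
      refine Nat.lt_succ_of_le (Nat.floor_le_floor ?_)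
      have := (hx.1 i).2
      gcongr
      exact_mod_cast (show b.repr x i - s i ≤ (t i : ℤ) by omega)
    · intro x hx y hy hxy
      rw [mem_coe, mem_filter, mem_coordBox] at hx hy
      rw [← sub_eq_zero]
      by_contra hne
      have h1 : ∀ k, ((AbsoluteValue.abs (b.repr (x - y) k) : ℤ) : ℝ) < ℓ := by
        intro i
        have h2 := congrFun hxy i
        simp only at h2
        have hnn : ∀ z : ℤ, 0 ≤ z → (⌊(z : ℝ) / ℓ⌋₊ : ℝ) ≤ z / ℓ ∧
            (z : ℝ) / ℓ < ⌊(z : ℝ) / ℓ⌋₊ + 1 := fun z hz =>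
          ⟨Nat.floor_le (div_nonneg (by exact_mod_cast hz) hℓ.le), Nat.lt_floor_add_one _⟩
        have hx' := hnn (b.repr x i - s i) (by have := (hx.1 i).1; omega)
        have hy' := hnn (b.repr y i - s i) (by have := (hy.1 i).1; omega)
        rw [h2] at hx'
        have h3 : |((b.repr x i - s i : ℤ) : ℝ) / ℓ - ((b.repr y i - s i : ℤ) : ℝ) / ℓ| < 1 := by
          rw [abs_lt]; constructor <;> linarith [hx'.1, hx'.2, hy'.1, hy'.2]
        rw [← sub_div, abs_div, abs_of_pos hℓ, div_lt_one hℓ] at h3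
        simpa using h3
      have h2 := ClassGroup.norm_lt (T := ℝ) AbsoluteValue.abs b (x - y) h1
      have h3 := Ideal.absNorm_dvd_norm_of_mem (𝔞.sub_mem hx.2 hy.2)
      have h4 := Int.le_of_dvd (abs_pos.mpr (Algebra.norm_ne_zero_iff.mpr hne))
        ((dvd_abs _ _).mpr h3)
      have h5 : ((Ideal.absNorm 𝔞 : ℤ) : ℝ) ≤ (|Algebra.norm ℤ (x - y)| : ℤ) := by exact_mod_cast h4
      rw [Int.cast_natCast] at h5
      simp only [AbsoluteValue.abs_apply] at h2
      linarith
  refine (Nat.cast_le.mpr key).trans ?_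
  rw [Fintype.card_piFinset, Nat.cast_prod]
  refine prod_le_prod (fun i _ => by positivity) fun i _ => ?_
  rw [card_range, Nat.cast_add, Nat.cast_one]
  have := Nat.floor_le (show 0 ≤ (t i : ℝ) / ℓ by positivity)
  gcongr

lemma exists_mem_repr_le {𝔞 : Ideal (𝓞 K)} (h0 : 𝔞 ≠ ⊥) {d : ℕ}
    (hd : Ideal.absNorm 𝔞 < d ^ Fintype.card ι) :
    ∃ α ∈ 𝔞, α ≠ 0 ∧ ∀ i, |b.repr α i| ≤ d := by
  classical
  have : Finite (𝓞 K ⧸ 𝔞) := Ideal.finiteQuotientOfFreeOfNeBot 𝔞 h0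
  have := Fintype.ofFinite (𝓞 K ⧸ 𝔞)
  have hc : #(univ : Finset (𝓞 K ⧸ 𝔞)) < #(coordBox b 0 fun _ => d) := by
    rw [card_coordBox, prod_const, card_univ, card_univ, ← Nat.card_eq_fintype_card]
    exact hd
  obtain ⟨x, hx, y, hy, hne, hxy⟩ := exists_ne_map_eq_of_card_lt_of_maps_to hc
    (f := Ideal.Quotient.mk 𝔞) fun _ _ => mem_coe.mpr (mem_univ _)
  refine ⟨x - y, Ideal.Quotient.eq.mp hxy, sub_ne_zero.mpr hne, fun i => ?_⟩
  have h1 := mem_coordBox.mp hx i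
  have h2 := mem_coordBox.mp hy i
  simp only [Pi.zero_apply] at h1 h2
  rw [map_sub, Finsupp.sub_apply, abs_le]
  constructor <;> linarith [h1.1, h1.2, h2.1, h2.2]

lemma exists_repr_mod_le : ∃ C : ℕ, ∀ 𝔞 : Ideal (𝓞 K), 𝔞 ≠ ⊥ → ∀ d : ℕ,
    Ideal.absNorm 𝔞 < d ^ Fintype.card ι → ∀ r : 𝓞 K, ∃ s : 𝓞 K, r - s ∈ 𝔞 ∧
      ∀ i, |b.repr s i| ≤ C * d := by
  obtain ⟨C, hC⟩ := exists_mul_repr_le b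
  refine ⟨C, fun 𝔞 h0 d hd r => ?_⟩
  obtain ⟨α, hα, hα0, hαd⟩ := exists_mem_repr_le b h0 hd
  set N := Ideal.absNorm (Ideal.span {α}) with hN
  have hN0 : 0 < N := one_le_absNorm (by simpa using hα0)
  obtain ⟨α', hα'⟩ := Ideal.mem_span_singleton'.mp (Ideal.absNorm_mem (Ideal.span {α}))
  rw [← hN] at hα'
  set Q : 𝓞 K := b.equivFun.symm fun i => b.repr (r * α') i / N with hQ
  set R : 𝓞 K := b.equivFun.symm fun i => b.repr (r * α') i % N with hR
  have hQi : ∀ i, b.repr Q i = b.repr (r * α') i / N := fun i => by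
    rw [← b.equivFun_apply, hQ, LinearEquiv.apply_symm_apply]
  have hRi : ∀ i, b.repr R i = b.repr (r * α') i % N := fun i => by
    rw [← b.equivFun_apply, hR, LinearEquiv.apply_symm_apply]
  have hQR : r * α' = (N : ℤ) • Q + R := by
    refine b.ext_elem fun i => ?_
    rw [map_add, map_smul, Finsupp.add_apply, Finsupp.smul_apply, hQi, hRi, smul_eq_mul,
      Int.mul_ediv_add_emod]
  have hs : (N : ℤ) • (r - α * Q) = α * R := by
    have h1 : R = r * α' - N * Q := by rw [hQR]; simp
    rw [h1]
    simp only [zsmul_eq_mul, Int.cast_natCast]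
    linear_combination (-r) * hα'
  refine ⟨r - α * Q, by simpa using 𝔞.mul_mem_right _ hα, fun i => ?_⟩
  have h2 := hC α R d N hαd (fun i => by
    rw [hRi, abs_of_nonneg (Int.emod_nonneg _ (by omega))]
    exact (Int.emod_lt_of_pos _ (by omega)).le) i
  rw [← hs, map_smul, Finsupp.smul_apply, smul_eq_mul, abs_mul, Nat.abs_cast, mul_comm] at h2
  exact le_of_mul_le_mul_right h2 (by exact_mod_cast hN0)

end Box

section BoxCount

variable {K : Type*} [Field K] [NumberField K] {ι : Type*} [Fintype ι] [DecidableEq ι]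
  (b : Module.Basis ι ℤ (𝓞 K))

open Classical in
lemma card_coordBox_filter_le_add {𝔞 : Ideal (𝓞 K)} {ℓ : ℝ} (hℓ : 0 < ℓ)
    (h : ClassGroup.normBound AbsoluteValue.abs b * ℓ ^ Fintype.card ι ≤ Ideal.absNorm 𝔞)
    (s s' : ι → ℤ) (D T : ℕ) (hs : ∀ i, |s i - s' i| ≤ D) :
    (#((coordBox b s fun _ => T).filter (· ∈ 𝔞)) : ℝ) ≤
      #((coordBox b s' fun _ => T).filter (· ∈ 𝔞)) +
        2 * Fintype.card ι * ((D / ℓ + 1) * (T / ℓ + 1) ^ (Fintype.card ι - 1)) := by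
  have hsub : (coordBox b s fun _ => T).filter (· ∈ 𝔞) ⊆
      (coordBox b s' fun _ => T).filter (· ∈ 𝔞) ∪
      univ.biUnion fun i =>
        (coordBox b s (Function.update (fun _ => T) i D)).filter (· ∈ 𝔞) ∪
        (coordBox b (Function.update s i (s i + T - D))
          (Function.update (fun _ => T) i D)).filter (· ∈ 𝔞) := by
    intro x hx
    rw [mem_filter, mem_coordBox] at hx
    simp only [mem_union, mem_biUnion, mem_univ, true_and, mem_filter, hx.2, and_true,
      mem_coordBox]
    by_contra! hcon
    obtain ⟨⟨i, hi⟩, hcon⟩ := hcon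
    have hsi := abs_le.mp (hs i)
    have hxi := hx.1 i
    obtain ⟨⟨j, hj⟩, ⟨k, hk⟩⟩ := hcon i
    have hxj := hx.1 j
    have hxk := hx.1 k
    have hj' : j = i := by
      by_contra hne
      rw [Function.update_of_ne hne] at hj
      have := hj hxj.1
      omega
    have hk' : k = i := by
      by_contra hne
      rw [Function.update_of_ne hne, Function.update_of_ne hne] at hk
      have := hk hxk.1
      omega
    subst hj' hk'
    rw [Function.update_self] at hj
    rw [Function.update_self, Function.update_self] at hk
    have h1 := hj hxj.1
    by_cases h2 : s' k ≤ b.repr x k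
    · have h3 := hi h2
      have h4 := hk (by omega)
      omega
    · omega
  have hprod : ∀ i : ι, ∏ j, (((Function.update (fun _ => T) i D : ι → ℕ) j : ℝ) / ℓ + 1) =
      (D / ℓ + 1) * (T / ℓ + 1) ^ (Fintype.card ι - 1) := by
    intro i
    rw [← mul_prod_erase _ _ (mem_univ i), Function.update_self]
    congr 1
    rw [prod_congr rfl (g := fun _ => (T / ℓ + 1 : ℝ)), prod_const, card_erase_of_mem (mem_univ i),
      card_univ]
    intro j hj
    rw [Function.update_of_ne (ne_of_mem_erase hj)]
  refine (Nat.cast_le.mpr ((card_le_card hsub).trans (card_union_le _ _))).trans ?_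
  rw [Nat.cast_add]
  gcongr
  refine (Nat.cast_le.mpr (card_biUnion_le.trans
    (sum_le_sum fun i _ => card_union_le _ _))).trans ?_
  push_cast
  calc _ ≤ ∑ i : ι, 2 * ((D / ℓ + 1) * (T / ℓ + 1) ^ (Fintype.card ι - 1)) := by
        refine sum_le_sum fun i _ => ?_
        rw [two_mul]
        refine add_le_add ?_ ?_ <;> rw [← hprod i] <;> exact card_coordBox_filter_le b hℓ h _ _
    _ = _ := by rw [sum_const, card_univ, nsmul_eq_mul]; ring

open Classical in
/-- The number of points of an ideal in a cube, with a uniform error term. -/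
lemma exists_abs_card_coordBox_filter_sub_le [Nonempty ι] : ∃ C : ℝ, 0 < C ∧
    ∀ 𝔞 : Ideal (𝓞 K), 𝔞 ≠ ⊥ → ∀ (s : ι → ℤ) (T : ℕ),
      |(#((coordBox b s fun _ => T).filter (· ∈ 𝔞)) : ℝ) -
        (T : ℝ) ^ Fintype.card ι / Ideal.absNorm 𝔞| ≤
      C * (T / (Ideal.absNorm 𝔞 : ℝ) ^ (1 / Fintype.card ι : ℝ) + 1) ^ (Fintype.card ι - 1) := by
  obtain ⟨C₁, hC₁⟩ := exists_repr_mod_le b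
  set n := Fintype.card ι with hn
  have hn0 : n ≠ 0 := Fintype.card_ne_zero
  set κ : ℝ := (ClassGroup.normBound AbsoluteValue.abs b : ℝ) with hκ
  have hκ1 : 1 ≤ κ := by
    have : 1 ≤ ClassGroup.normBound AbsoluteValue.abs b := ClassGroup.normBound_pos _ b
    exact Int.cast_one_le_of_pos this
  refine ⟨2 * n * ((2 * C₁ * κ + 1) * κ ^ (n - 1)), by positivity, fun 𝔞 h0 s T => ?_⟩
  set N := Ideal.absNorm 𝔞 with hN
  have hN1 : (1 : ℝ) ≤ N := by exact_mod_cast one_le_absNorm h0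
  set u : ℝ := (N : ℝ) ^ (1 / n : ℝ) with hu
  have hu1 : 1 ≤ u := Real.one_le_rpow hN1 (by positivity)
  have hun : u ^ n = N := by
    rw [hu, one_div, Real.rpow_inv_natCast_pow (by positivity) hn0]
  set d := ⌊u⌋₊ + 1 with hd
  have hdu : u < d := by rw [hd]; push_cast; exact Nat.lt_floor_add_one u
  have hd2 : (d : ℝ) ≤ 2 * u := by
    have := Nat.floor_le (zero_le_one.trans hu1)
    rw [hd]; push_cast; linarith
  have hdn : N < d ^ n := by
    have : (N : ℝ) < (d : ℝ) ^ n := by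
      rw [← hun]; exact pow_lt_pow_left₀ hdu (by positivity) hn0
    exact_mod_cast this
  set ℓ := u / κ with hℓ
  have hℓ0 : 0 < ℓ := by positivity
  have hℓn : κ * ℓ ^ n ≤ N := by
    rw [hℓ, div_pow, hun, mul_div_assoc', div_le_iff₀ (by positivity), mul_comm]
    gcongr
    exact le_self_pow₀ hκ1 hn0
  set E := 2 * n * (((C₁ * d : ℕ) / ℓ + 1) * (T / ℓ + 1) ^ (n - 1)) with hE
  have hEle : E ≤ 2 * n * ((2 * C₁ * κ + 1) * κ ^ (n - 1)) * (T / u + 1) ^ (n - 1) := by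
    have h1 : ((C₁ * d : ℕ) / ℓ : ℝ) ≤ 2 * C₁ * κ := by
      rw [hℓ, div_div_eq_mul_div, div_le_iff₀ (by positivity)]
      push_cast
      have : (C₁ : ℝ) * d * κ ≤ C₁ * (2 * u) * κ := by gcongr
      linarith
    have h2 : (T / ℓ + 1 : ℝ) ≤ κ * (T / u + 1) := by
      rw [hℓ, div_div_eq_mul_div, mul_add, mul_one, mul_comm κ, div_mul_eq_mul_div]
      gcongr
    calc E ≤ 2 * n * ((2 * C₁ * κ + 1) * (κ * (T / u + 1)) ^ (n - 1)) := by rw [hE]; gcongr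
      _ = _ := by rw [mul_pow]; ring
  refine le_trans ?_ hEle
  have : Finite (𝓞 K ⧸ 𝔞) := Ideal.finiteQuotientOfFreeOfNeBot 𝔞 h0
  have := Fintype.ofFinite (𝓞 K ⧸ 𝔞)
  have hclass : ∀ q : 𝓞 K ⧸ 𝔞,
      |(#((coordBox b s fun _ => T).filter (Ideal.Quotient.mk 𝔞 · = q)) : ℝ) -
        #((coordBox b s fun _ => T).filter (· ∈ 𝔞))| ≤ E := by
    intro q
    obtain ⟨r, rfl⟩ := Ideal.Quotient.mk_surjective q
    obtain ⟨t, hrt, ht⟩ := hC₁ 𝔞 h0 d hdn r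
    have hcard : #((coordBox b s fun _ => T).filter
        (Ideal.Quotient.mk 𝔞 · = Ideal.Quotient.mk 𝔞 r)) =
        #((coordBox b (fun i => s i - b.repr t i) fun _ => T).filter (· ∈ 𝔞)) := by
      refine card_bij' (fun x _ => x - t) (fun x _ => x + t) ?_ ?_ (fun _ _ => by simp)
        (fun _ _ => by simp)
      · intro x hx
        rw [mem_filter, mem_coordBox] at hx ⊢
        refine ⟨fun i => ?_, ?_⟩
        · have := hx.1 i
          rw [map_sub, Finsupp.sub_apply]
          omega
        · rw [← sub_add_sub_cancel x r t]
          exact 𝔞.add_mem (Ideal.Quotient.eq.mp hx.2) hrt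
      · intro x hx
        rw [mem_filter, mem_coordBox] at hx ⊢
        refine ⟨fun i => ?_, ?_⟩
        · have := hx.1 i
          rw [map_add, Finsupp.add_apply]
          omega
        · rw [Ideal.Quotient.eq, show x + t - r = x - (r - t) by ring]
          exact 𝔞.sub_mem hx.2 hrt
    rw [hcard, abs_le]
    have h1 := card_coordBox_filter_le_add b hℓ0 hℓn (fun i => s i - b.repr t i) s (C₁ * d) T
      (fun i => by simpa using ht i)
    have h2 := card_coordBox_filter_le_add b hℓ0 hℓn s (fun i => s i - b.repr t i) (C₁ * d) T
      (fun i => by simpa using ht i)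
    constructor <;> linarith
  have hsum : ∑ q : 𝓞 K ⧸ 𝔞,
      (#((coordBox b s fun _ => T).filter (Ideal.Quotient.mk 𝔞 · = q)) : ℝ) = (T : ℝ) ^ n := by
    have h := card_eq_sum_card_fiberwise (s := coordBox b s fun _ => T) (f := Ideal.Quotient.mk 𝔞)
      (t := univ) fun _ _ => mem_coe.mpr (mem_univ _)
    rw [card_coordBox, prod_const, card_univ] at h
    rw [← Nat.cast_sum, ← Nat.cast_pow, h]
  have hcardN : (Fintype.card (𝓞 K ⧸ 𝔞) : ℝ) = N := by
    rw [← Nat.card_eq_fintype_card]; rfl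
  set f := (#((coordBox b s fun _ => T).filter (· ∈ 𝔞)) : ℝ)
  have h1 : |(T : ℝ) ^ n - N * f| ≤ N * E := by
    rw [← hsum, ← hcardN, ← nsmul_eq_mul, ← nsmul_eq_mul, ← card_univ, ← sum_const, ← sum_const,
      ← sum_sub_distrib]
    exact (abs_sum_le_sum_abs _ _).trans (sum_le_sum fun q _ => hclass q)
  have hNpos : (0 : ℝ) < N := by linarith
  rw [abs_sub_comm, show (T : ℝ) ^ n / N - f = (T ^ n - N * f) / N by field_simp, abs_div,
    abs_of_pos hNpos, div_le_iff₀ hNpos]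
  linarith

end BoxCount

section LogIdentity

variable {K : Type*} [Field K] [NumberField K]

open UniqueFactorizationMonoid in
open Classical in
lemma pow_dvd_iff_le_count {P I : Ideal (𝓞 K)} (hP : P.IsPrime) (h0 : P ≠ ⊥) (hI : I ≠ ⊥) (j : ℕ) :
    P ^ j ∣ I ↔ j ≤ (normalizedFactors I).count P := by
  have hirr : Irreducible P := (Ideal.prime_of_isPrime h0 hP).irreducible
  rw [dvd_iff_normalizedFactors_le_normalizedFactors (pow_ne_zero j h0) hI, normalizedFactors_pow,
    normalizedFactors_irreducible hirr, normalize_eq, Multiset.nsmul_singleton,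
    Multiset.le_count_iff_replicate_le]

open UniqueFactorizationMonoid in
open Classical in
lemma log_absNorm_eq_sum {I : Ideal (𝓞 K)} (hI : I ≠ ⊥) {M : ℕ} (hM : Ideal.absNorm I ≤ M) :
    Real.log (Ideal.absNorm I) =
      ∑ x ∈ (primePows K M).filter fun x => x.1 ^ x.2 ∣ I, Real.log (Ideal.absNorm x.1) := by
  have h1 := sum_finset_product ((primePows K M).filter fun x => x.1 ^ x.2 ∣ I)
    (normalizedFactors I).toFinset (fun P => Icc 1 ((normalizedFactors I).count P))
    (f := fun x => Real.log (Ideal.absNorm x.1)) ?_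
  · rw [h1]
    simp only [sum_const, Nat.card_Icc, Nat.add_sub_cancel]
    rw [← Finset.sum_multiset_map_count]
    conv_lhs => rw [← Ideal.prod_normalizedFactors_eq_self hI]
    rw [map_multiset_prod, Nat.cast_multiset_prod, Real.log_multiset_prod, Multiset.map_map,
      Multiset.map_map]
    · rfl
    · simp only [Multiset.mem_map]
      rintro _ ⟨_, ⟨P, hP, rfl⟩, rfl⟩
      exact (absNorm_cast_pos (prime_of_normalized_factor P hP).ne_zero).ne'
  · rintro ⟨P, j⟩
    simp only [mem_filter, mem_primePows, Multiset.mem_toFinset, mem_Icc]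
    constructor
    · rintro ⟨⟨h0, hP, hj, -⟩, hdvd⟩
      have := (pow_dvd_iff_le_count hP h0 hI j).mp hdvd
      exact ⟨Multiset.count_pos.mp (by omega), hj, this⟩
    · rintro ⟨hmem, hj, hle⟩
      have hp := prime_of_normalized_factor P hmem
      have hP : P.IsPrime := Ideal.isPrime_of_prime hp
      have hdvd := (pow_dvd_iff_le_count hP hp.ne_zero hI j).mpr hle
      refine ⟨⟨hp.ne_zero, hP, hj, ?_⟩, hdvd⟩
      rw [← map_pow]
      exact (Nat.le_of_dvd (one_le_absNorm hI) (map_dvd Ideal.absNorm hdvd)).trans hM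

end LogIdentity

section NormBounds

variable {K : Type*} [Field K] [NumberField K] {ι : Type*} [Fintype ι] [DecidableEq ι]
  (b : Module.Basis ι ℤ (𝓞 K))

lemma cast_absNorm_span_eq_prod (x : 𝓞 K) :
    (Ideal.absNorm (Ideal.span {x}) : ℝ) = ∏ σ : K →ₐ[ℚ] ℂ, ‖σ x‖ := by
  rw [← norm_prod, ← Algebra.norm_eq_prod_embeddings ℚ ℂ (x : K), Ideal.absNorm_span_singleton,
    ← Algebra.coe_norm_int]
  simp [Nat.cast_natAbs]

/-- There are cubes of any side length `T` on which the norm has order of magnitude `T ^ n`. -/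
lemma exists_coordBox_absNorm : ∃ C : ℕ, 1 ≤ C ∧ ∃ s : ℕ → ι → ℤ, ∀ T : ℕ, 1 ≤ T →
    ∀ x ∈ coordBox b (s T) (fun _ => T), x ≠ 0 ∧
      T ^ Module.finrank ℚ K ≤ Ideal.absNorm (Ideal.span {x}) ∧
      Ideal.absNorm (Ideal.span {x}) ≤ C * T ^ Module.finrank ℚ K := by
  set A : ℕ := ⌈∑ σ : K →ₐ[ℚ] ℂ, ∑ i, ‖σ (b i)‖⌉₊ with hA
  refine ⟨(2 * A + 1) ^ Module.finrank ℚ K, Nat.one_le_pow _ _ (by omega),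
    fun T i => (A + 1) * T * b.repr 1 i, fun T hT x hx => ?_⟩
  have hcard : Fintype.card (K →ₐ[ℚ] ℂ) = Module.finrank ℚ K := AlgHom.card ℚ K ℂ
  set y : 𝓞 K := x - ((A + 1) * T : ℤ) • 1 with hy
  have hyi : ∀ i, 0 ≤ b.repr y i ∧ b.repr y i < T := by
    intro i
    have := mem_coordBox.mp hx i
    rw [hy, map_sub, map_smul, Finsupp.sub_apply, Finsupp.smul_apply, smul_eq_mul]
    constructor <;> linarith [this.1, this.2]
  have hσy : ∀ σ : K →ₐ[ℚ] ℂ, ‖σ y‖ ≤ A * T := by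
    intro σ
    have h1 : σ y = ∑ i, (b.repr y i : ℂ) * σ (b i) := by
      conv_lhs => rw [← b.sum_repr y]
      simp [map_sum]
    rw [h1]
    refine (norm_sum_le _ _).trans ?_
    calc ∑ i, ‖(b.repr y i : ℂ) * σ (b i)‖ ≤ ∑ i, T * ‖σ (b i)‖ := by
          refine sum_le_sum fun i _ => ?_
          rw [norm_mul, Complex.norm_intCast]
          gcongr
          rw [abs_of_nonneg (by exact_mod_cast (hyi i).1)]
          exact_mod_cast (hyi i).2.le
      _ = T * ∑ i, ‖σ (b i)‖ := by rw [mul_sum]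
      _ ≤ T * A := by
          gcongr
          refine le_trans ?_ (Nat.le_ceil _)
          exact single_le_sum (f := fun σ : K →ₐ[ℚ] ℂ => ∑ i, ‖σ (b i)‖)
            (fun _ _ => by positivity) (mem_univ σ)
      _ = A * T := mul_comm _ _
  have hσx : ∀ σ : K →ₐ[ℚ] ℂ, (T : ℝ) ≤ ‖σ x‖ ∧ ‖σ x‖ ≤ (2 * A + 1) * T := by
    intro σ
    have h1 : σ x = σ y + ((A + 1) * T : ℝ) := by rw [hy]; simp
    have h2 : ‖(((A + 1) * T : ℝ) : ℂ)‖ = (A + 1) * T := by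
      rw [Complex.norm_real, Real.norm_of_nonneg (by positivity)]
    constructor
    · have := norm_sub_le (σ x) (σ y)
      rw [h1, add_sub_cancel_left, h2, ← h1] at this
      linarith [hσy σ]
    · rw [h1]
      refine (norm_add_le _ _).trans ?_
      rw [h2]
      linarith [hσy σ]
  have hlow : T ^ Module.finrank ℚ K ≤ Ideal.absNorm (Ideal.span {x}) := by
    have : (T : ℝ) ^ Module.finrank ℚ K ≤ Ideal.absNorm (Ideal.span {x}) := by
      rw [cast_absNorm_span_eq_prod, ← hcard, ← card_univ, ← prod_const]
      exact prod_le_prod (fun _ _ => by positivity) fun σ _ => (hσx σ).1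
    exact_mod_cast this
  refine ⟨?_, hlow, ?_⟩
  · rintro rfl
    have : 0 < T ^ Module.finrank ℚ K := Nat.pow_pos hT
    simp at hlow
    omega
  · rw [← mul_pow]
    have : (Ideal.absNorm (Ideal.span {x}) : ℝ) ≤ ((2 * A + 1) * T) ^ Module.finrank ℚ K := by
      rw [cast_absNorm_span_eq_prod, ← hcard, ← card_univ, ← prod_const]
      exact prod_le_prod (fun _ _ => by positivity) fun σ _ => (hσx σ).2
    exact_mod_cast this

end NormBounds

section Mertens

variable (K : Type*) [Field K] [NumberField K]

/-- The sum of `log |P| / |P| ^ j` over the prime ideal powers `P ^ j` of norm at most `N`. -/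
noncomputable def mertensSum (N : ℕ) : ℝ :=
  ∑ x ∈ primePows K N, Real.log (Ideal.absNorm x.1) / (Ideal.absNorm x.1 : ℝ) ^ x.2

variable {K}

lemma mertensSum_mono : Monotone (mertensSum K) := fun _ _ h =>
  sum_le_sum_of_subset_of_nonneg (primePows_mono h) fun x _ _ =>
    div_nonneg (log_absNorm_nonneg _) (by positivity)

lemma mertensSum_nonneg (N : ℕ) : 0 ≤ mertensSum K N :=
  sum_nonneg fun x _ => div_nonneg (log_absNorm_nonneg _) (by positivity)

lemma rpow_div_le_sum {δ : ℝ} (hδ : 0 < δ) {y m : ℕ} (hm : 1 ≤ m) (hmy : m ≤ y) :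
    ((y : ℝ) / m) ^ (1 - δ) ≤ 2 * ∑ k ∈ Icc 1 (y / m), (k : ℝ) ^ (-δ) := by
  set q := y / m with hq
  have hm0 : (0 : ℝ) < m := by exact_mod_cast hm
  have hq1 : 1 ≤ q := (Nat.one_le_div_iff hm).mpr hmy
  have hqz : (q : ℝ) ≤ (y : ℝ) / m := Nat.cast_div_le
  have hq1' : (1 : ℝ) ≤ q := by exact_mod_cast hq1
  have hzq : (y : ℝ) / m ≤ 2 * q := by
    have h : y < (q + 1) * m := by
      rw [mul_comm]; exact Nat.lt_mul_div_succ y hm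
    rw [div_le_iff₀ hm0]
    have h' : (y : ℝ) ≤ (q + 1) * m := by exact_mod_cast h.le
    nlinarith
  have hz : (0 : ℝ) < (y : ℝ) / m := by linarith
  calc ((y : ℝ) / m) ^ (1 - δ) = (y / m) * ((y : ℝ) / m) ^ (-δ) := by
        rw [sub_eq_add_neg, Real.rpow_add hz, Real.rpow_one]
    _ ≤ 2 * q * ((y : ℝ) / m) ^ (-δ) := by gcongr
    _ = 2 * ∑ k ∈ Icc 1 q, ((y : ℝ) / m) ^ (-δ) := by
        rw [sum_const, Nat.card_Icc, nsmul_eq_mul, Nat.add_sub_cancel, mul_assoc]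
    _ ≤ _ := by
        refine mul_le_mul_of_nonneg_left (sum_le_sum fun k hk => ?_) zero_le_two
        rw [mem_Icc] at hk
        refine Real.rpow_le_rpow_of_nonpos (by exact_mod_cast hk.1) ?_ (by linarith)
        exact le_trans (by exact_mod_cast hk.2) hqz

variable (K) in
lemma exists_sum_primePows_rpow_le {δ : ℝ} (hδ : 0 < δ) : ∃ C : ℝ, 0 < C ∧ ∀ y : ℕ,
    ∑ x ∈ primePows K y, Real.log (Ideal.absNorm x.1) *
      ((y : ℝ) / (Ideal.absNorm x.1 ^ x.2 : ℕ)) ^ (1 - δ) ≤ C * y := by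
  obtain ⟨C, hC, hcheb⟩ := exists_sum_primePows_log_le K
  have hsum : Summable fun k : ℕ => (k : ℝ) ^ (-1 - δ) := Real.summable_nat_rpow.mpr (by linarith)
  set Z := ∑' k : ℕ, (k : ℝ) ^ (-1 - δ) with hZ
  have hZ0 : 0 ≤ Z := tsum_nonneg fun k => by positivity
  refine ⟨2 * C * (Z + 1), by positivity, fun y => ?_⟩
  calc _ ≤ ∑ x ∈ primePows K y, ∑ k ∈ Icc 1 (y / Ideal.absNorm x.1 ^ x.2),
          2 * ((k : ℝ) ^ (-δ) * Real.log (Ideal.absNorm x.1)) := by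
        refine sum_le_sum fun x hx => ?_
        obtain ⟨h0, hP, hj, hm⟩ := mem_primePows.mp hx
        have h1 := rpow_div_le_sum hδ (Nat.pow_pos (n := x.2) (one_le_absNorm h0)) hm
        rw [← mul_sum, ← sum_mul, ← mul_assoc, mul_comm]
        exact mul_le_mul_of_nonneg_right h1 (log_absNorm_nonneg _)
    _ = ∑ k ∈ Icc 1 y, ∑ x ∈ primePows K (y / k),
          2 * ((k : ℝ) ^ (-δ) * Real.log (Ideal.absNorm x.1)) := by
        refine sum_comm' fun x k => ?_
        simp only [mem_primePows, mem_Icc]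
        constructor
        · rintro ⟨⟨h0, hP, hj, hm⟩, hk1, hk⟩
          have hpos : 0 < Ideal.absNorm x.1 ^ x.2 := Nat.pow_pos (one_le_absNorm h0)
          rw [Nat.le_div_iff_mul_le hpos] at hk
          refine ⟨⟨h0, hP, hj, ?_⟩, hk1, ?_⟩
          · rw [Nat.le_div_iff_mul_le (by omega), mul_comm]; exact hk
          · exact (Nat.le_mul_of_pos_right _ hpos).trans hk
        · rintro ⟨⟨h0, hP, hj, hm⟩, hk1, hk⟩
          have hpos : 0 < Ideal.absNorm x.1 ^ x.2 := Nat.pow_pos (one_le_absNorm h0)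
          rw [Nat.le_div_iff_mul_le (by omega)] at hm
          refine ⟨⟨h0, hP, hj, (Nat.le_mul_of_pos_right _ (by omega)).trans hm⟩, hk1, ?_⟩
          rw [Nat.le_div_iff_mul_le hpos, mul_comm]; exact hm
    _ ≤ ∑ k ∈ Icc 1 y, 2 * C * y * (k : ℝ) ^ (-1 - δ) := by
        refine sum_le_sum fun k hk => ?_
        have hk1 : (0 : ℝ) < k := by exact_mod_cast (mem_Icc.mp hk).1
        rw [← mul_sum, ← mul_sum]
        have h1 : ∑ x ∈ primePows K (y / k), Real.log (Ideal.absNorm x.1) ≤ C * (y / k) :=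
          (hcheb _).trans (mul_le_mul_of_nonneg_left Nat.cast_div_le hC.le)
        have h2 : (k : ℝ) ^ (-1 - δ) = (k : ℝ) ^ (-δ) / k := by
          rw [show -1 - δ = -δ - 1 by ring, Real.rpow_sub_one hk1.ne']
        calc 2 * ((k : ℝ) ^ (-δ) * ∑ x ∈ primePows K (y / k), Real.log (Ideal.absNorm x.1))
            ≤ 2 * ((k : ℝ) ^ (-δ) * (C * (y / k))) := by gcongr
          _ = _ := by rw [h2]; ring
    _ = 2 * C * y * ∑ k ∈ Icc 1 y, (k : ℝ) ^ (-1 - δ) := by rw [mul_sum]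
    _ ≤ 2 * C * y * Z :=
        mul_le_mul_of_nonneg_left (hsum.sum_le_tsum _ fun k _ => by positivity) (by positivity)
    _ ≤ 2 * C * y * (Z + 1) := by gcongr; linarith
    _ = _ := by ring

variable (K) in
open Classical in
lemma exists_abs_mertensSum_pow_sub_le : ∃ C : ℝ, 0 < C ∧ ∃ A : ℕ, 1 ≤ A ∧ ∀ T : ℕ, 1 ≤ T →
    |mertensSum K (A * T ^ Module.finrank ℚ K) - Module.finrank ℚ K * Real.log T| ≤ C := by
  have hcardι : Fintype.card (Module.Free.ChooseBasisIndex ℤ (𝓞 K)) = Module.finrank ℚ K := by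
    rw [← RingOfIntegers.rank K, Module.finrank_eq_card_basis (RingOfIntegers.basis K)]
  have hn0 : 0 < Module.finrank ℚ K := Module.finrank_pos
  have : Nonempty (Module.Free.ChooseBasisIndex ℤ (𝓞 K)) :=
    Fintype.card_pos_iff.mp (by omega)
  obtain ⟨A, hA, s, hs⟩ := exists_coordBox_absNorm (RingOfIntegers.basis K)
  obtain ⟨C, hC, hcount⟩ := exists_abs_card_coordBox_filter_sub_le (RingOfIntegers.basis K)
  rw [hcardι] at hcount
  set n := Module.finrank ℚ K with hn
  have hn0' : (0 : ℝ) < n := by exact_mod_cast hn0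
  obtain ⟨D, hD, hsmooth⟩ := exists_sum_primePows_rpow_le K (δ := 1 / n) (by positivity)
  have hA' : (1 : ℝ) ≤ A := by exact_mod_cast hA
  have hlogA := Real.log_nonneg hA'
  refine ⟨Real.log A + C * 2 ^ (n - 1) * D * A, by positivity, A, hA, fun T hT => ?_⟩
  set y := A * T ^ n with hy
  set B := coordBox (RingOfIntegers.basis K) (s T) fun _ => T with hB
  have hT0 : (0 : ℝ) < T := by exact_mod_cast hT
  have hcardB : (#B : ℝ) = T ^ n := by
    rw [hB, card_coordBox, prod_const, card_univ, hcardι, Nat.cast_pow]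
  have h1 : ∑ α ∈ B, Real.log (Ideal.absNorm (Ideal.span {α})) =
      ∑ x ∈ primePows K y, Real.log (Ideal.absNorm x.1) * #(B.filter (· ∈ x.1 ^ x.2)) := by
    rw [sum_congr rfl fun α hα => log_absNorm_eq_sum
      (by simpa using (hs T hT α hα).1) (hs T hT α hα).2.2]
    simp only [sum_filter]
    rw [sum_comm]
    refine sum_congr rfl fun x _ => ?_
    simp only [Ideal.dvd_span_singleton]
    rw [← sum_filter, sum_const, nsmul_eq_mul, mul_comm]
  have h2 : (T : ℝ) ^ n * (n * Real.log T) ≤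
      ∑ α ∈ B, Real.log (Ideal.absNorm (Ideal.span {α})) := by
    rw [← hcardB, ← nsmul_eq_mul]
    refine card_nsmul_le_sum _ _ _ fun α hα => ?_
    rw [← Real.log_pow]
    exact Real.log_le_log (by positivity) (by exact_mod_cast (hs T hT α hα).2.1)
  have h3 : ∑ α ∈ B, Real.log (Ideal.absNorm (Ideal.span {α})) ≤
      (T : ℝ) ^ n * (n * Real.log T + Real.log A) := by
    rw [← hcardB, ← nsmul_eq_mul]
    refine sum_le_card_nsmul _ _ _ fun α hα => ?_
    rw [← Real.log_pow, add_comm, ← Real.log_mul (by positivity) (by positivity)]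
    refine Real.log_le_log (absNorm_cast_pos (by simpa using (hs T hT α hα).1)) ?_
    exact_mod_cast (hs T hT α hα).2.2
  have h4 : |∑ x ∈ primePows K y, Real.log (Ideal.absNorm x.1) * #(B.filter (· ∈ x.1 ^ x.2)) -
      (T : ℝ) ^ n * mertensSum K y| ≤ C * 2 ^ (n - 1) * (D * y) := by
    rw [mertensSum, mul_sum, ← sum_sub_distrib]
    refine (abs_sum_le_sum_abs _ _).trans ?_
    refine le_trans ?_ (mul_le_mul_of_nonneg_left (hsmooth y) (by positivity))
    rw [mul_sum]
    refine sum_le_sum fun x hx => ?_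
    obtain ⟨h0, hP, hj, hm⟩ := mem_primePows.mp hx
    set m := Ideal.absNorm x.1 ^ x.2 with hm'
    have hm0 : 0 < m := Nat.pow_pos (one_le_absNorm h0)
    have hm0' : (0 : ℝ) < m := by exact_mod_cast hm0
    have h5 := hcount (x.1 ^ x.2) (pow_ne_zero _ h0) (s T) T
    rw [map_pow, ← hm'] at h5
    have h6 : Real.log (Ideal.absNorm x.1) * #(B.filter (· ∈ x.1 ^ x.2)) -
        (T : ℝ) ^ n * (Real.log (Ideal.absNorm x.1) / (Ideal.absNorm x.1 : ℝ) ^ x.2) =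
        Real.log (Ideal.absNorm x.1) * (#(B.filter (· ∈ x.1 ^ x.2)) - (T : ℝ) ^ n / m) := by
      rw [hm']; push_cast; ring
    rw [h6, abs_mul, abs_of_nonneg (log_absNorm_nonneg _), mul_left_comm]
    refine mul_le_mul_of_nonneg_left (h5.trans ?_) (log_absNorm_nonneg _)
    rw [mul_assoc]
    refine mul_le_mul_of_nonneg_left ?_ hC.le
    set w := ((y : ℝ) / m) ^ (1 / n : ℝ) with hw
    have hz1 : (1 : ℝ) ≤ (y : ℝ) / m := by
      rw [le_div_iff₀ hm0', one_mul]; exact_mod_cast hm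
    have hw1 : 1 ≤ w := Real.one_le_rpow hz1 (by positivity)
    have hTw : T / (m : ℝ) ^ (1 / n : ℝ) ≤ w := by
      have : (T : ℝ) = ((T : ℝ) ^ n) ^ (1 / n : ℝ) := by
        rw [one_div, Real.pow_rpow_inv_natCast hT0.le hn0.ne']
      rw [this, ← Real.div_rpow (by positivity) (by positivity)]
      refine Real.rpow_le_rpow (by positivity) ?_ (by positivity)
      gcongr
      rw [hy]; push_cast
      exact le_mul_of_one_le_left (by positivity) hA'
    have hwn : w ^ (n - 1) = ((y : ℝ) / m) ^ (1 - 1 / n : ℝ) := by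
      rw [hw, ← Real.rpow_natCast, ← Real.rpow_mul (by positivity), Nat.cast_sub hn0]
      congr 1
      field_simp
      push_cast; ring
    rw [← hwn, ← mul_pow]
    gcongr
    linarith
  rw [← h1] at h4
  have hTn : (0 : ℝ) < (T : ℝ) ^ n := by positivity
  have hyT : (y : ℝ) = A * T ^ n := by rw [hy]; push_cast; ring
  rw [hyT] at h4
  rw [abs_le] at h4 ⊢
  constructor
  · refine le_of_mul_le_mul_left ?_ hTn
    nlinarith [h4.1, h4.2]
  · refine le_of_mul_le_mul_left ?_ hTn
    nlinarith [h4.1, h4.2]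

variable (K) in
/-- Mertens' theorem for prime ideal powers. -/
lemma exists_abs_mertensSum_sub_log_le : ∃ C : ℝ, 0 < C ∧ ∀ N : ℕ, 1 ≤ N →
    |mertensSum K N - Real.log N| ≤ C := by
  obtain ⟨C, hC, A, hA, h⟩ := exists_abs_mertensSum_pow_sub_le K
  set n := Module.finrank ℚ K with hn
  have hn0 : 0 < n := Module.finrank_pos
  have hA' : (1 : ℝ) ≤ A := by exact_mod_cast hA
  have hlogA := Real.log_nonneg hA'
  have hlog2 := Real.log_nonneg one_le_two
  refine ⟨C + Real.log A + n * Real.log 2, by positivity, fun N hN => ?_⟩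
  have hN' : (1 : ℝ) ≤ N := by exact_mod_cast hN
  have hlogN := Real.log_nonneg hN'
  have hn2 : 0 ≤ n * Real.log 2 := by positivity
  rcases lt_or_ge N A with hlt | hge
  · have h1 := h 1 le_rfl
    have h2 : mertensSum K N ≤ mertensSum K (A * 1 ^ n) := mertensSum_mono (by simpa using hlt.le)
    have h3 := mertensSum_nonneg (K := K) N
    have h4 : Real.log N ≤ Real.log A := Real.log_le_log (by linarith) (by exact_mod_cast hlt.le)
    simp only [Nat.cast_one, Real.log_one, mul_zero, sub_zero] at h1
    rw [abs_le] at h1 ⊢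
    constructor <;> linarith [h1.1, h1.2]
  · obtain ⟨T, hT1, hTN, hNT⟩ : ∃ T : ℕ, 1 ≤ T ∧ A * T ^ n ≤ N ∧ N < A * (T + 1) ^ n := by
      have hex : ∃ T : ℕ, N < A * (T + 1) ^ n := by
        refine ⟨N, ?_⟩
        calc N < N + 1 := Nat.lt_succ_self N
          _ ≤ (N + 1) ^ n := Nat.le_self_pow hn0.ne' _
          _ ≤ _ := Nat.le_mul_of_pos_left _ hA
      classical
      refine ⟨Nat.find hex, ?_, ?_, Nat.find_spec hex⟩
      · rw [Nat.one_le_iff_ne_zero]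
        intro h0
        have := Nat.find_spec hex
        rw [h0] at this
        simp at this; omega
      · by_contra! hlt
        rcases Nat.eq_zero_or_pos (Nat.find hex) with h0 | h0
        · rw [h0, zero_pow hn0.ne'] at hlt; omega
        · refine Nat.find_min hex (m := Nat.find hex - 1) (by omega) ?_
          rwa [Nat.sub_add_cancel h0]
    have hT0 : (1 : ℝ) ≤ T := by exact_mod_cast hT1
    have h1 := abs_le.mp (h T hT1)
    have h2 := abs_le.mp (h (T + 1) (by omega))
    have h3 : mertensSum K (A * T ^ n) ≤ mertensSum K N := mertensSum_mono hTN
    have h4 : mertensSum K N ≤ mertensSum K (A * (T + 1) ^ n) := mertensSum_mono hNT.le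
    have h5 : Real.log (T + 1 : ℕ) ≤ Real.log 2 + Real.log T := by
      rw [← Real.log_mul (by norm_num) (by positivity)]
      refine Real.log_le_log (by positivity) ?_
      push_cast; linarith
    have h6 : Real.log A + n * Real.log T ≤ Real.log N := by
      rw [← Real.log_pow, ← Real.log_mul (by positivity) (by positivity)]
      exact Real.log_le_log (by positivity) (by exact_mod_cast hTN)
    have h7 : Real.log N ≤ Real.log A + n * Real.log (T + 1 : ℕ) := by
      rw [← Real.log_pow, ← Real.log_mul (by positivity) (by positivity)]
      exact Real.log_le_log (by positivity) (by exact_mod_cast hNT.le)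
    have h8 : n * Real.log (T + 1 : ℕ) ≤ n * Real.log 2 + n * Real.log T := by
      rw [← mul_add]; gcongr
    rw [abs_le]
    constructor <;> linarith [h1.1, h1.2, h2.1, h2.2]

end Mertens

section SplitPrimes

variable {k L : Type*} [Field k] [NumberField k] [Field L] [NumberField L] [Algebra k L]

lemma absNorm_eq_of_splitsIn (hdeg : Module.finrank k L = 2) {P : Ideal (𝓞 k)} (h0 : P ≠ ⊥)
    {Q₁ Q₂ : Ideal (𝓞 L)} (hne : Q₁ ≠ Q₂) (h₁ : Q₁.IsPrime) (h₂ : Q₂.IsPrime) (h₁0 : Q₁ ≠ ⊥)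
    (h₂0 : Q₂ ≠ ⊥) (hc₁ : Q₁.comap (algebraMap (𝓞 k) (𝓞 L)) = P)
    (hc₂ : Q₂.comap (algebraMap (𝓞 k) (𝓞 L)) = P) :
    Ideal.absNorm Q₁ = Ideal.absNorm P ∧ Ideal.absNorm Q₂ = Ideal.absNorm P := by
  classical
  have hP : P.IsPrime := hc₁ ▸ Ideal.comap_isPrime _ _
  have hPnorm := two_le_absNorm hP h0
  have : P.IsMaximal := hP.isMaximal h0
  have : Q₁.LiesOver P := ⟨hc₁.symm⟩
  have : Q₂.LiesOver P := ⟨hc₂.symm⟩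
  have e₁ := Ideal.absNorm_eq_pow_inertiaDeg'_of_liesOver Q₁ P hP h0
  have e₂ := Ideal.absNorm_eq_pow_inertiaDeg'_of_liesOver Q₂ P hP h0
  have f₁ := Ideal.inertiaDeg'_pos P Q₁
  have f₂ := Ideal.inertiaDeg'_pos P Q₂
  have hdvd : Q₁ * Q₂ ∣ P.map (algebraMap (𝓞 k) (𝓞 L)) := by
    rw [← prod_pair (f := fun Q => Q) hne]
    refine Finset.prod_primes_dvd _ ?_ ?_
    · intro Q hQ
      rcases mem_insert.mp hQ with rfl | hQ
      · exact Ideal.prime_of_isPrime h₁0 h₁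
      · rw [mem_singleton.mp hQ]; exact Ideal.prime_of_isPrime h₂0 h₂
    · intro Q hQ
      rw [Ideal.dvd_iff_le, Ideal.map_le_iff_le_comap]
      rcases mem_insert.mp hQ with rfl | hQ
      · exact hc₁.ge
      · rw [mem_singleton.mp hQ]; exact hc₂.ge
  have h1 := map_dvd Ideal.absNorm hdvd
  have hfin : Module.finrank (𝓞 k) (𝓞 L) = 2 := by
    rw [← hdeg]; exact (IsFractionRing.finrank_eq (𝓞 k) k (𝓞 L) L).symm
  rw [map_mul, Ideal.absNorm_algebraMap, hfin, e₁, e₂, ← pow_add,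
    Nat.pow_dvd_pow_iff_le_right (by omega)] at h1
  rw [e₁, e₂, show P.inertiaDeg' Q₁ = 1 by omega, show P.inertiaDeg' Q₂ = 1 by omega, pow_one]
  exact ⟨rfl, rfl⟩

variable (k L) in
/-- Choice of two primes above each split prime. -/
lemma exists_primes_above (hdeg : Module.finrank k L = 2) :
    ∃ Q : Bool → Ideal (𝓞 k) → Ideal (𝓞 L), ∀ P : Ideal (𝓞 k), P ≠ ⊥ → SplitsIn k L P →
      Q true P ≠ Q false P ∧ ∀ i, (Q i P).IsPrime ∧ Q i P ≠ ⊥ ∧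
        (Q i P).comap (algebraMap (𝓞 k) (𝓞 L)) = P ∧
        Ideal.absNorm (Q i P) = Ideal.absNorm P := by
  have h : ∀ P : Ideal (𝓞 k), ∃ q : Bool → Ideal (𝓞 L), P ≠ ⊥ → SplitsIn k L P →
      q true ≠ q false ∧ ∀ i, (q i).IsPrime ∧ q i ≠ ⊥ ∧
        (q i).comap (algebraMap (𝓞 k) (𝓞 L)) = P ∧ Ideal.absNorm (q i) = Ideal.absNorm P := by
    intro P
    by_cases hP : P ≠ ⊥ ∧ SplitsIn k L P
    · obtain ⟨h0, Q₁, Q₂, hne, h₁, h₂, h₁0, h₂0, hc₁, hc₂⟩ := hP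
      obtain ⟨e₁, e₂⟩ := absNorm_eq_of_splitsIn hdeg h0 hne h₁ h₂ h₁0 h₂0 hc₁ hc₂
      exact ⟨fun i => bif i then Q₁ else Q₂, fun _ _ => ⟨hne, fun i => by cases i <;> simp [*]⟩⟩
    · exact ⟨fun _ => ⊥, fun h0 hs => absurd ⟨h0, hs⟩ hP⟩
  choose q hq using h
  exact ⟨fun i P => q P i, hq⟩

end SplitPrimes

section PrimeSums

variable {K : Type*} [Field K] [NumberField K]

variable (K) in
lemma exists_sum_primePows_two_le : ∃ C : ℝ, 0 < C ∧ ∀ N : ℕ,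
    ∑ x ∈ (primePows K N).filter fun x => 2 ≤ x.2,
      Real.log (Ideal.absNorm x.1) / (Ideal.absNorm x.1 : ℝ) ^ x.2 ≤ C := by
  classical
  obtain ⟨C, hC, h⟩ := exists_sum_rpow_absNorm_le K
  refine ⟨4 * C, by positivity, fun N => ?_⟩
  have hsub : (primePows K N).filter (fun x => 2 ≤ x.2) ⊆
      ((idealsLE K N).filter (·.IsPrime)) ×ˢ Ico 2 (N + 1) := by
    intro x hx
    simp only [primePows, mem_filter, mem_product, mem_Icc, mem_Ico] at hx ⊢
    exact ⟨⟨hx.1.1.1, hx.1.2.1⟩, hx.2, by omega⟩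
  refine (sum_le_sum_of_subset_of_nonneg hsub fun x _ _ =>
    div_nonneg (log_absNorm_nonneg _) (by positivity)).trans ?_
  rw [sum_product]
  calc _ ≤ ∑ P ∈ (idealsLE K N).filter (·.IsPrime), 4 * (Ideal.absNorm P : ℝ) ^ (-(3 / 2) : ℝ) := by
        refine sum_le_sum fun P hP => ?_
        rw [mem_filter, mem_idealsLE] at hP
        set m : ℝ := (Ideal.absNorm P : ℝ) with hm
        have hm2 : (2 : ℝ) ≤ m := by
          have := two_le_absNorm hP.2 hP.1.1
          rw [hm]; exact_mod_cast this
        have hm0 : 0 < m := by linarith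
        have hinv : m⁻¹ ≤ 1 / 2 := by rw [one_div]; gcongr
        have h1 : ∑ j ∈ Ico 2 (N + 1), m⁻¹ ^ j ≤ m⁻¹ ^ 2 / (1 - m⁻¹) :=
          geom_sum_Ico_le_of_lt_one (by positivity) (by linarith)
        have h2 : m⁻¹ ^ 2 / (1 - m⁻¹) ≤ 2 * m⁻¹ ^ 2 := by
          rw [div_le_iff₀ (by linarith)]
          nlinarith [sq_nonneg m⁻¹]
        have h3 : Real.log m ≤ 2 * m ^ (1 / 2 : ℝ) := by
          have := Real.log_le_rpow_div hm0.le (show (0 : ℝ) < 1 / 2 by norm_num)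
          linarith
        have h4 : m ^ (-(3 / 2) : ℝ) = m ^ (1 / 2 : ℝ) * m⁻¹ ^ 2 := by
          rw [inv_pow, ← Real.rpow_natCast, ← Real.rpow_neg hm0.le, ← Real.rpow_add hm0]
          norm_num
        calc ∑ j ∈ Ico 2 (N + 1), Real.log m / m ^ j
            = Real.log m * ∑ j ∈ Ico 2 (N + 1), m⁻¹ ^ j := by
              rw [mul_sum]
              exact sum_congr rfl fun j _ => by rw [inv_pow, div_eq_mul_inv]
          _ ≤ 2 * m ^ (1 / 2 : ℝ) * (2 * m⁻¹ ^ 2) := by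
              refine mul_le_mul h3 (h1.trans h2) (sum_nonneg fun _ _ => by positivity)
                (by positivity)
          _ = _ := by rw [h4]; ring
    _ ≤ ∑ P ∈ idealsLE K N, 4 * (Ideal.absNorm P : ℝ) ^ (-(3 / 2) : ℝ) :=
        sum_le_sum_of_subset_of_nonneg (filter_subset _ _) fun _ _ _ => by positivity
    _ ≤ 4 * C := by rw [← mul_sum]; exact mul_le_mul_of_nonneg_left (h N) (by norm_num)

variable (K) in
open Classical in
/-- The nonzero primes of norm at most `N` with property `S`. -/
noncomputable def primesLE (S : Ideal (𝓞 K) → Prop) (N : ℕ) : Finset (Ideal (𝓞 K)) :=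
  (idealsLE K N).filter fun P => P.IsPrime ∧ S P

variable {S : Ideal (𝓞 K) → Prop}

lemma mem_primesLE {N : ℕ} {P : Ideal (𝓞 K)} :
    P ∈ primesLE K S N ↔ P ≠ ⊥ ∧ Ideal.absNorm P ≤ N ∧ P.IsPrime ∧ S P := by
  simp only [primesLE, mem_filter, mem_idealsLE, and_assoc]

lemma primesLE_mono {M N : ℕ} (h : M ≤ N) : primesLE K S M ⊆ primesLE K S N := by
  intro P
  simp only [mem_primesLE]
  exact fun ⟨a, b, c⟩ => ⟨a, b.trans h, c⟩

lemma mertensSum_sub {x y : ℕ} (hxy : x ≤ y) : mertensSum K y - mertensSum K x =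
    ∑ z ∈ (primePows K y).filter fun z => x < Ideal.absNorm z.1 ^ z.2,
      Real.log (Ideal.absNorm z.1) / (Ideal.absNorm z.1 : ℝ) ^ z.2 := by
  have : primePows K x = (primePows K y).filter fun z => ¬ x < Ideal.absNorm z.1 ^ z.2 := by
    ext z
    simp only [mem_filter, mem_primePows, not_lt]
    constructor
    · exact fun ⟨a, b, c, d⟩ => ⟨⟨a, b, c, d.trans hxy⟩, d⟩
    · exact fun ⟨⟨a, b, c, _⟩, d⟩ => ⟨a, b, c, d⟩
  rw [mertensSum, mertensSum, this, ← sum_filter_add_sum_filter_not (primePows K y)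
    (fun z => x < Ideal.absNorm z.1 ^ z.2), add_sub_cancel_right]

variable (K) in
lemma exists_mertensSum_sub_le : ∃ C : ℝ, 0 < C ∧ ∀ x y : ℕ, x ≤ y →
    mertensSum K y - mertensSum K x ≤
      ∑ P ∈ (primesLE K (fun _ => True) y).filter fun P => x < Ideal.absNorm P,
        Real.log (Ideal.absNorm P) / Ideal.absNorm P + C := by
  obtain ⟨C, hC, h⟩ := exists_sum_primePows_two_le K
  refine ⟨C, hC, fun x y hxy => ?_⟩
  rw [mertensSum_sub hxy, ← sum_filter_add_sum_filter_not _ (fun z => z.2 = 1)]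
  refine add_le_add (le_of_eq ?_) (le_trans (sum_le_sum_of_subset_of_nonneg ?_ ?_) (h y))
  · refine sum_bij' (fun z _ => z.1) (fun P _ => (P, 1)) ?_ ?_ ?_ ?_ ?_
    · rintro ⟨P, j⟩ hz
      simp only [mem_filter, mem_primePows, mem_primesLE] at hz ⊢
      obtain ⟨⟨⟨a, b, c, d⟩, e⟩, rfl⟩ := hz
      rw [pow_one] at d e
      exact ⟨⟨a, d, b, trivial⟩, e⟩
    · intro P hP
      simp only [mem_filter, mem_primePows, mem_primesLE] at hP ⊢
      simp only [pow_one]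
      exact ⟨⟨⟨hP.1.1, hP.1.2.2.1, le_rfl, hP.1.2.1⟩, hP.2⟩, trivial⟩
    · rintro ⟨P, j⟩ hz
      simp only [mem_filter] at hz
      exact Prod.ext rfl hz.2.symm
    · intros; rfl
    · rintro ⟨P, j⟩ hz
      simp only [mem_filter] at hz
      simp only [hz.2, pow_one]
  · intro z hz
    simp only [mem_filter, mem_primePows] at hz ⊢
    exact ⟨hz.1.1, by have := hz.1.1.2.2.1; have := hz.2; omega⟩
  · exact fun _ _ _ => div_nonneg (log_absNorm_nonneg _) (by positivity)

end PrimeSums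

section Nonsplit

variable (k L : Type*) [Field k] [NumberField k] [Field L] [NumberField L] [Algebra k L]

lemma two_mul_sum_split_le (hdeg : Module.finrank k L = 2) {x y : ℕ} (hxy : x ≤ y) :
    2 * ∑ P ∈ (primesLE k (SplitsIn k L) y).filter fun P => x < Ideal.absNorm P,
        Real.log (Ideal.absNorm P) / Ideal.absNorm P ≤ mertensSum L y - mertensSum L x := by
  classical
  obtain ⟨Q, hQ⟩ := exists_primes_above k L hdeg
  rw [mertensSum_sub hxy]
  set s := (primesLE k (SplitsIn k L) y).filter fun P => x < Ideal.absNorm P with hs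
  have hs' : ∀ P ∈ s, P ≠ ⊥ ∧ SplitsIn k L P ∧ Ideal.absNorm P ≤ y ∧ x < Ideal.absNorm P := by
    intro P hP
    rw [hs, mem_filter, mem_primesLE] at hP
    exact ⟨hP.1.1, hP.1.2.2.2, hP.1.2.1, hP.2⟩
  have hinj : Set.InjOn (fun z : Bool × Ideal (𝓞 k) => (Q z.1 z.2, 1))
      (((univ : Finset Bool) ×ˢ s : Finset (Bool × Ideal (𝓞 k))) : Set (Bool × Ideal (𝓞 k))) := by
    rintro ⟨i, P⟩ hz ⟨i', P'⟩ hz' h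
    rw [mem_coe, mem_product] at hz hz'
    obtain ⟨h0, hsp, -⟩ := hs' P hz.2
    obtain ⟨h0', hsp', -⟩ := hs' P' hz'.2
    have hQQ : Q i P = Q i' P' := congrArg Prod.fst h
    have hPP : P = P' := by
      rw [← ((hQ P h0 hsp).2 i).2.2.1, hQQ, ((hQ P' h0' hsp').2 i').2.2.1]
    subst hPP
    have hne := (hQ P h0 hsp).1
    cases i <;> cases i' <;> simp_all
  calc _ = ∑ z ∈ (univ : Finset Bool) ×ˢ s,
        Real.log (Ideal.absNorm z.2) / Ideal.absNorm z.2 := by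
        rw [sum_product]
        simp [two_mul]
    _ = ∑ z ∈ ((univ : Finset Bool) ×ˢ s).image fun z => (Q z.1 z.2, 1),
        Real.log (Ideal.absNorm z.1) / (Ideal.absNorm z.1 : ℝ) ^ z.2 := by
        rw [sum_image hinj]
        refine sum_congr rfl fun z hz => ?_
        obtain ⟨h0, hsp, -⟩ := hs' z.2 (mem_product.mp hz).2
        rw [((hQ z.2 h0 hsp).2 z.1).2.2.2, pow_one]
    _ ≤ _ := by
        refine sum_le_sum_of_subset_of_nonneg (fun w hw => ?_)
          fun _ _ _ => div_nonneg (log_absNorm_nonneg _) (by positivity)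
        obtain ⟨z, hz, rfl⟩ := mem_image.mp hw
        obtain ⟨h0, hsp, hy, hx⟩ := hs' z.2 (mem_product.mp hz).2
        obtain ⟨a, b, -, d⟩ := (hQ z.2 h0 hsp).2 z.1
        rw [mem_filter, mem_primePows]
        simp only [pow_one, d]
        exact ⟨⟨b, a, le_rfl, hy⟩, hx⟩

/-- The primes not split in a quadratic extension have lower density at least one half. -/
lemma exists_le_sum_nonsplit (hdeg : Module.finrank k L = 2) : ∃ C : ℝ, ∀ x y : ℕ, 1 ≤ x → x ≤ y →
    1 / 2 * (Real.log y - Real.log x) - C ≤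
      ∑ P ∈ (primesLE k (fun P => ¬ SplitsIn k L P) y).filter fun P => x < Ideal.absNorm P,
        Real.log (Ideal.absNorm P) / Ideal.absNorm P := by
  classical
  obtain ⟨C₁, -, h₁⟩ := exists_mertensSum_sub_le k
  obtain ⟨C₂, -, h₂⟩ := exists_abs_mertensSum_sub_log_le k
  obtain ⟨C₃, -, h₃⟩ := exists_abs_mertensSum_sub_log_le L
  refine ⟨C₁ + 2 * C₂ + C₃, fun x y hx hxy => ?_⟩
  have hsplit := two_mul_sum_split_le k L hdeg hxy
  have hall := h₁ x y hxy
  have e₁ := abs_le.mp (h₂ x hx)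
  have e₂ := abs_le.mp (h₂ y (hx.trans hxy))
  have e₃ := abs_le.mp (h₃ x hx)
  have e₄ := abs_le.mp (h₃ y (hx.trans hxy))
  have hdec : ∑ P ∈ (primesLE k (fun _ => True) y).filter fun P => x < Ideal.absNorm P,
        Real.log (Ideal.absNorm P) / Ideal.absNorm P =
      ∑ P ∈ (primesLE k (SplitsIn k L) y).filter fun P => x < Ideal.absNorm P,
        Real.log (Ideal.absNorm P) / Ideal.absNorm P +
      ∑ P ∈ (primesLE k (fun P => ¬ SplitsIn k L P) y).filter fun P => x < Ideal.absNorm P,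
        Real.log (Ideal.absNorm P) / Ideal.absNorm P := by
    rw [← sum_filter_add_sum_filter_not _ (SplitsIn k L)]
    congr 1 <;> refine sum_congr ?_ fun _ _ => rfl <;> ext P <;>
      simp only [mem_filter, mem_primesLE] <;> tauto
  linarith [e₁.1, e₁.2, e₂.1, e₂.2, e₃.1, e₃.2, e₄.1, e₄.2]

lemma exists_le_theta_nonsplit (hdeg : Module.finrank k L = 2) : ∃ c : ℝ, 0 < c ∧ ∃ N₀ : ℕ,
    ∀ N ≥ N₀, c * N ≤
      ∑ P ∈ primesLE k (fun P => ¬ SplitsIn k L P) N, Real.log (Ideal.absNorm P) := by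
  obtain ⟨C, h⟩ := exists_le_sum_nonsplit k L hdeg
  set R : ℕ := ⌈Real.exp (2 * (C + 1))⌉₊ with hR
  have hRexp : Real.exp (2 * (C + 1)) ≤ R := Nat.le_ceil _
  have hR0 : (0 : ℝ) < R := (Real.exp_pos _).trans_le hRexp
  have hR0' : 0 < R := by exact_mod_cast hR0
  refine ⟨1 / (2 * R), by positivity, R, fun N hN => ?_⟩
  set x := N / R with hx
  have hx1 : 1 ≤ x := (Nat.one_le_div_iff hR0').mpr hN
  have hx0 : (0 : ℝ) < x := by exact_mod_cast hx1
  have hxR : R * x ≤ N := Nat.mul_div_le N R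
  have h1 := h x (R * x) hx1 (Nat.le_mul_of_pos_left _ hR0')
  have h2 : C + 1 ≤ 1 / 2 * (Real.log (R * x : ℕ) - Real.log x) := by
    push_cast
    rw [Real.log_mul hR0.ne' hx0.ne', add_sub_cancel_right]
    have := (Real.le_log_iff_exp_le hR0).mpr hRexp
    linarith
  have h3 : (N : ℝ) ≤ 2 * R * x := by
    have h4 : N < R * (x + 1) := Nat.lt_mul_div_succ N hR0'
    have h5 : N ≤ 2 * R * x := by nlinarith
    exact_mod_cast h5
  calc 1 / (2 * R) * (N : ℝ) ≤ x := by
        rw [one_div, inv_mul_le_iff₀ (by positivity)]; exact h3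
    _ ≤ x * ∑ P ∈ (primesLE k (fun P => ¬ SplitsIn k L P) (R * x)).filter
          fun P => x < Ideal.absNorm P, Real.log (Ideal.absNorm P) / Ideal.absNorm P :=
        le_mul_of_one_le_right hx0.le (by linarith)
    _ ≤ ∑ P ∈ (primesLE k (fun P => ¬ SplitsIn k L P) (R * x)).filter
          fun P => x < Ideal.absNorm P, Real.log (Ideal.absNorm P) := by
        rw [mul_sum]
        refine sum_le_sum fun P hP => ?_
        have hxP : (x : ℝ) < Ideal.absNorm P := by exact_mod_cast (mem_filter.mp hP).2
        rw [mul_div_assoc', div_le_iff₀ (hx0.trans hxP), mul_comm]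
        exact mul_le_mul_of_nonneg_left hxP.le (log_absNorm_nonneg _)
    _ ≤ _ := sum_le_sum_of_subset_of_nonneg
        ((filter_subset _ _).trans (primesLE_mono hxR)) fun _ _ _ => log_absNorm_nonneg _

end Nonsplit

section Supported

variable {K : Type*} [Field K] [NumberField K]

variable (K) in
open Classical in
/-- The nonzero ideals of norm at most `N` all of whose prime divisors satisfy `S`. -/
noncomputable def supportedLE (S : Ideal (𝓞 K) → Prop) (N : ℕ) : Finset (Ideal (𝓞 K)) :=
  (idealsLE K N).filter fun I => ∀ P : Ideal (𝓞 K), P.IsPrime → P ∣ I → S P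

variable (K) in
open Classical in
/-- The squarefree ideals of norm at most `N` all of whose prime divisors satisfy `S`. -/
noncomputable def squarefreeLE (S : Ideal (𝓞 K) → Prop) (N : ℕ) : Finset (Ideal (𝓞 K)) :=
  (supportedLE K S N).filter Squarefree

variable {S : Ideal (𝓞 K) → Prop}

lemma mem_supportedLE {N : ℕ} {I : Ideal (𝓞 K)} :
    I ∈ supportedLE K S N ↔ I ≠ ⊥ ∧ Ideal.absNorm I ≤ N ∧
      ∀ P : Ideal (𝓞 K), P.IsPrime → P ∣ I → S P := by
  simp only [supportedLE, mem_filter, mem_idealsLE, and_assoc]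

lemma mem_squarefreeLE {N : ℕ} {I : Ideal (𝓞 K)} :
    I ∈ squarefreeLE K S N ↔ I ≠ ⊥ ∧ Ideal.absNorm I ≤ N ∧
      (∀ P : Ideal (𝓞 K), P.IsPrime → P ∣ I → S P) ∧ Squarefree I := by
  simp only [squarefreeLE, mem_filter, mem_supportedLE, and_assoc]

lemma squarefreeLE_mono {M N : ℕ} (h : M ≤ N) : squarefreeLE K S M ⊆ squarefreeLE K S N := by
  intro I
  simp only [mem_squarefreeLE]
  exact fun ⟨a, b, c⟩ => ⟨a, b.trans h, c⟩

variable (S) in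
/-- Every nonzero ideal is a squarefree ideal supported on `S` times an ideal supported on the
complement of `S` times a square. -/
lemma exists_eq_squarefree_mul_mul_sq (I : Ideal (𝓞 K)) (hI : I ≠ ⊥) :
    ∃ m b c : Ideal (𝓞 K), I = m * b * c ^ 2 ∧ Squarefree m ∧
      (∀ P : Ideal (𝓞 K), P.IsPrime → P ∣ m → S P) ∧
      (∀ P : Ideal (𝓞 K), P.IsPrime → P ∣ b → ¬ S P) := by
  induction I using UniqueFactorizationMonoid.induction_on_prime with
  | h₁ => exact absurd rfl hI
  | h₂ x hx =>
    refine ⟨1, 1, 1, by rw [one_pow, mul_one, mul_one, Ideal.isUnit_iff.mp hx,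
      Ideal.one_eq_top], squarefree_one, ?_, ?_⟩ <;>
      exact fun P hP h => absurd (Ideal.isUnit_iff.mp (isUnit_of_dvd_one h)) hP.ne_top
  | h₃ a p ha hp ih =>
    obtain ⟨m, b, c, rfl, hm, hmS, hbS⟩ := ih ha
    have hdvd : ∀ P J : Ideal (𝓞 K), P.IsPrime → P ≠ ⊥ → P ∣ p * J → P = p ∨ P ∣ J := by
      intro P J hP h0 h
      rcases (Ideal.prime_of_isPrime h0 hP).dvd_mul.mp h with h | h
      · exact Or.inl (associated_iff_eq.mp ((Ideal.prime_of_isPrime h0 hP).associated_of_dvd hp h))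
      · exact Or.inr h
    have hne : ∀ P J : Ideal (𝓞 K), J ≠ ⊥ → P ∣ J → P ≠ ⊥ :=
      fun P J hJ h => ne_zero_of_dvd_ne_zero hJ h
    have hm0 : m ≠ ⊥ := hm.ne_zero
    have hb0 : b ≠ ⊥ := right_ne_zero_of_mul (left_ne_zero_of_mul ha)
    by_cases hSp : S p
    · by_cases hpm : p ∣ m
      · obtain ⟨m', rfl⟩ := hpm
        exact ⟨m', b, p * c, by ring, hm.of_mul_right,
          fun P hP h => hmS P hP (h.mul_left _), hbS⟩
      · refine ⟨p * m, b, c, by ring, ?_, ?_, hbS⟩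
        · exact squarefree_mul_iff.mpr
            ⟨hp.irreducible.isRelPrime_iff_not_dvd.mpr hpm, hp.irreducible.squarefree, hm⟩
        · intro P hP h
          rcases hdvd P m hP (hne _ _ (mul_ne_zero hp.ne_zero hm0) h) h with rfl | h
          · exact hSp
          · exact hmS P hP h
    · refine ⟨m, p * b, c, by ring, hm, hmS, ?_⟩
      intro P hP h
      rcases hdvd P b hP (hne _ _ (mul_ne_zero hp.ne_zero hb0) h) h with rfl | h
      · exact hSp
      · exact hbS P hP h

variable (K S) in
lemma exists_sum_inv_absNorm_le_mul : ∃ C : ℝ, 0 < C ∧ ∀ N : ℕ,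
    ∑ I ∈ idealsLE K N, (Ideal.absNorm I : ℝ)⁻¹ ≤
      C * (∑ m ∈ squarefreeLE K S N, (Ideal.absNorm m : ℝ)⁻¹) *
        ∑ b ∈ supportedLE K (fun P => ¬ S P) N, (Ideal.absNorm b : ℝ)⁻¹ := by
  classical
  obtain ⟨C, hC, h⟩ := exists_sum_rpow_absNorm_le K
  refine ⟨C, hC, fun N => ?_⟩
  set A := squarefreeLE K S N with hA
  set B := supportedLE K (fun P => ¬ S P) N with hB
  set f : Ideal (𝓞 K) × Ideal (𝓞 K) × Ideal (𝓞 K) → Ideal (𝓞 K) :=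
    fun z => z.1 * z.2.1 * z.2.2 ^ 2 with hf
  have hcov : idealsLE K N ⊆ (A ×ˢ B ×ˢ idealsLE K N).image f := by
    intro I hI
    rw [mem_idealsLE] at hI
    obtain ⟨m, b, c, rfl, hm, hmS, hbS⟩ := exists_eq_squarefree_mul_mul_sq S I hI.1
    have hle : ∀ J, J ∣ m * b * c ^ 2 → J ≠ ⊥ ∧ Ideal.absNorm J ≤ N := fun J hJ =>
      ⟨ne_zero_of_dvd_ne_zero hI.1 hJ,
        (Nat.le_of_dvd (one_le_absNorm hI.1) (map_dvd Ideal.absNorm hJ)).trans hI.2⟩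
    refine mem_image.mpr ⟨(m, b, c), ?_, rfl⟩
    have h1 := hle m ((dvd_mul_right m b).mul_right _)
    have h2 := hle b ((dvd_mul_left b m).mul_right _)
    have h3 := hle c ((dvd_pow_self c two_ne_zero).mul_left _)
    simp only [mem_product, hA, hB, mem_squarefreeLE, mem_supportedLE, mem_idealsLE]
    exact ⟨⟨h1.1, h1.2, hmS, hm⟩, ⟨h2.1, h2.2, hbS⟩, h3⟩
  calc _ ≤ ∑ I ∈ (A ×ˢ B ×ˢ idealsLE K N).image f, (Ideal.absNorm I : ℝ)⁻¹ :=
        sum_le_sum_of_subset_of_nonneg hcov fun _ _ _ => by positivity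
    _ ≤ ∑ z ∈ A ×ˢ B ×ˢ idealsLE K N, (Ideal.absNorm (f z) : ℝ)⁻¹ :=
        sum_image_le_of_nonneg fun _ _ => by positivity
    _ = (∑ m ∈ A, (Ideal.absNorm m : ℝ)⁻¹) * (∑ b ∈ B, (Ideal.absNorm b : ℝ)⁻¹) *
          ∑ c ∈ idealsLE K N, ((Ideal.absNorm c : ℝ) ^ 2)⁻¹ := by
        simp only [hf, map_mul, map_pow, Nat.cast_mul, Nat.cast_pow, mul_inv, sum_product,
          ← mul_sum, ← sum_mul, mul_assoc]
    _ ≤ (∑ m ∈ A, (Ideal.absNorm m : ℝ)⁻¹) * (∑ b ∈ B, (Ideal.absNorm b : ℝ)⁻¹) * C := by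
        refine mul_le_mul_of_nonneg_left ((sum_le_sum fun c hc => ?_).trans (h N))
          (mul_nonneg (sum_nonneg fun _ _ => by positivity) (sum_nonneg fun _ _ => by positivity))
        rw [mem_idealsLE] at hc
        have h1 : (1 : ℝ) ≤ Ideal.absNorm c := by exact_mod_cast one_le_absNorm hc.1
        rw [← Real.rpow_natCast, ← Real.rpow_neg (by positivity)]
        exact Real.rpow_le_rpow_of_exponent_le h1 (by norm_num)
    _ = _ := by ring

end Supported

section SplitSupported

variable (k L : Type*) [Field k] [NumberField k] [Field L] [NumberField L] [Algebra k L]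

open UniqueFactorizationMonoid in
/-- Pairs of ideals supported on split primes embed, preserving norms, in the ideals of `L`. -/
lemma sum_split_supported_sq_le (hdeg : Module.finrank k L = 2) (N : ℕ) :
    (∑ b ∈ supportedLE k (SplitsIn k L) N, (Ideal.absNorm b : ℝ)⁻¹) ^ 2 ≤
      ∑ J ∈ idealsLE L (N ^ 2), (Ideal.absNorm J : ℝ)⁻¹ := by
  classical
  obtain ⟨Q, hQ⟩ := exists_primes_above k L hdeg
  set B := supportedLE k (SplitsIn k L) N with hB
  set lift : Bool → Ideal (𝓞 k) → Ideal (𝓞 L) := fun i b =>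
    ((normalizedFactors b).map (Q i)).prod with hlift
  set down : Bool → Ideal (𝓞 L) → Ideal (𝓞 k) := fun i J =>
    (((normalizedFactors J).filter fun q => q = Q i (q.comap (algebraMap (𝓞 k) (𝓞 L)))).map
      (Ideal.comap (algebraMap (𝓞 k) (𝓞 L)))).prod with hdown
  have hfac : ∀ b ∈ B, ∀ P ∈ normalizedFactors b, P ≠ ⊥ ∧ SplitsIn k L P := by
    intro b hb P hP
    have hp := prime_of_normalized_factor P hP
    exact ⟨hp.ne_zero, (mem_supportedLE.mp hb).2.2 P (Ideal.isPrime_of_prime hp)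
      (dvd_of_mem_normalizedFactors hP)⟩
  have hnorm : ∀ i, ∀ b ∈ B, Ideal.absNorm (lift i b) = Ideal.absNorm b := by
    intro i b hb
    conv_rhs => rw [← Ideal.prod_normalizedFactors_eq_self (mem_supportedLE.mp hb).1]
    rw [hlift, map_multiset_prod, map_multiset_prod, Multiset.map_map]
    refine congrArg _ (Multiset.map_congr rfl fun P hP => ?_)
    exact ((hQ P (hfac b hb P hP).1 (hfac b hb P hP).2).2 i).2.2.2
  have hnf : ∀ b₁ ∈ B, ∀ b₂ ∈ B, normalizedFactors (lift true b₁ * lift false b₂) =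
      (normalizedFactors b₁).map (Q true) + (normalizedFactors b₂).map (Q false) := by
    intro b₁ h₁ b₂ h₂
    rw [hlift, ← Multiset.prod_add]
    refine normalizedFactors_prod_of_prime fun q hq => ?_
    rcases Multiset.mem_add.mp hq with hq | hq <;> obtain ⟨P, hP, rfl⟩ := Multiset.mem_map.mp hq
    · obtain ⟨a, b, -⟩ := (hQ P (hfac b₁ h₁ P hP).1 (hfac b₁ h₁ P hP).2).2 true
      exact Ideal.prime_of_isPrime b a
    · obtain ⟨a, b, -⟩ := (hQ P (hfac b₂ h₂ P hP).1 (hfac b₂ h₂ P hP).2).2 false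
      exact Ideal.prime_of_isPrime b a
  have hsame : ∀ i, ∀ b ∈ B, (((normalizedFactors b).map (Q i)).filter
      fun q => q = Q i (q.comap (algebraMap (𝓞 k) (𝓞 L)))).map
        (Ideal.comap (algebraMap (𝓞 k) (𝓞 L))) = normalizedFactors b := by
    intro i b hb
    rw [Multiset.filter_eq_self.mpr, Multiset.map_map]
    · conv_rhs => rw [← Multiset.map_id (normalizedFactors b)]
      exact Multiset.map_congr rfl fun P hP =>
        ((hQ P (hfac b hb P hP).1 (hfac b hb P hP).2).2 i).2.2.1
    · intro q hq
      obtain ⟨P, hP, rfl⟩ := Multiset.mem_map.mp hq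
      rw [((hQ P (hfac b hb P hP).1 (hfac b hb P hP).2).2 i).2.2.1]
  have hdiff : ∀ i j, i ≠ j → ∀ b ∈ B, ((normalizedFactors b).map (Q i)).filter
      (fun q => q = Q j (q.comap (algebraMap (𝓞 k) (𝓞 L)))) = 0 := by
    intro i j hij b hb
    refine Multiset.filter_eq_nil.mpr fun q hq => ?_
    obtain ⟨P, hP, rfl⟩ := Multiset.mem_map.mp hq
    obtain ⟨hne, h⟩ := hQ P (hfac b hb P hP).1 (hfac b hb P hP).2
    rw [(h i).2.2.1]
    cases i <;> cases j
    exacts [absurd rfl hij, hne.symm, hne, absurd rfl hij]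
  have hd₁ : ∀ b₁ ∈ B, ∀ b₂ ∈ B, down true (lift true b₁ * lift false b₂) = b₁ := by
    intro b₁ h₁ b₂ h₂
    rw [hdown]
    simp only []
    rw [hnf b₁ h₁ b₂ h₂, Multiset.filter_add, hdiff false true (by simp) b₂ h₂, add_zero,
      hsame true b₁ h₁, Ideal.prod_normalizedFactors_eq_self (mem_supportedLE.mp h₁).1]
  have hd₂ : ∀ b₁ ∈ B, ∀ b₂ ∈ B, down false (lift true b₁ * lift false b₂) = b₂ := by
    intro b₁ h₁ b₂ h₂
    rw [hdown]
    simp only []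
    rw [hnf b₁ h₁ b₂ h₂, Multiset.filter_add, hdiff true false (by simp) b₁ h₁, zero_add,
      hsame false b₂ h₂, Ideal.prod_normalizedFactors_eq_self (mem_supportedLE.mp h₂).1]
  have hinj : Set.InjOn (fun z : Ideal (𝓞 k) × Ideal (𝓞 k) => lift true z.1 * lift false z.2)
      ((B ×ˢ B : Finset (Ideal (𝓞 k) × Ideal (𝓞 k))) : Set (Ideal (𝓞 k) × Ideal (𝓞 k))) := by
    rintro ⟨b₁, b₂⟩ hb ⟨b₁', b₂'⟩ hb' h
    rw [mem_coe, mem_product] at hb hb'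
    simp only at h hb hb'
    refine Prod.ext ?_ ?_
    · rw [← hd₁ b₁ hb.1 b₂ hb.2, h, hd₁ b₁' hb'.1 b₂' hb'.2]
    · rw [← hd₂ b₁ hb.1 b₂ hb.2, h, hd₂ b₁' hb'.1 b₂' hb'.2]
  calc _ = ∑ z ∈ B ×ˢ B, (Ideal.absNorm (lift true z.1 * lift false z.2) : ℝ)⁻¹ := by
        rw [sq, sum_mul_sum, ← sum_product']
        refine sum_congr rfl fun z hz => ?_
        obtain ⟨h₁, h₂⟩ := mem_product.mp hz
        rw [map_mul, hnorm _ _ h₁, hnorm _ _ h₂, Nat.cast_mul, mul_inv]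
    _ = ∑ J ∈ (B ×ˢ B).image fun z => lift true z.1 * lift false z.2,
          (Ideal.absNorm J : ℝ)⁻¹ := by rw [sum_image hinj]
    _ ≤ _ := by
        refine sum_le_sum_of_subset_of_nonneg (fun J hJ => ?_) fun _ _ _ => by positivity
        obtain ⟨z, hz, rfl⟩ := mem_image.mp hJ
        obtain ⟨h₁, h₂⟩ := mem_product.mp hz
        have e : Ideal.absNorm (lift true z.1 * lift false z.2) =
            Ideal.absNorm z.1 * Ideal.absNorm z.2 := by
          rw [map_mul, hnorm _ _ h₁, hnorm _ _ h₂]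
        have m₁ := mem_supportedLE.mp h₁
        have m₂ := mem_supportedLE.mp h₂
        rw [mem_idealsLE, e, sq]
        refine ⟨fun h0 => ?_, Nat.mul_le_mul m₁.2.1 m₂.2.1⟩
        rw [h0, Ideal.absNorm_bot] at e
        exact (Nat.mul_pos (one_le_absNorm m₁.1) (one_le_absNorm m₂.1)).ne e

lemma exists_le_sum_squarefree_nonsplit (hdeg : Module.finrank k L = 2) :
    ∃ c : ℝ, 0 < c ∧ ∃ N₀ : ℕ, ∀ N ≥ N₀, c * √(Real.log N) ≤
      ∑ m ∈ squarefreeLE k (fun P => ¬ SplitsIn k L P) N, (Ideal.absNorm m : ℝ)⁻¹ := by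
  obtain ⟨c₁, hc₁, C₁, h₁⟩ := exists_le_sum_inv_absNorm k
  obtain ⟨C₂, hC₂, h₂⟩ := exists_sum_inv_absNorm_le L
  obtain ⟨C₃, hC₃, h₃⟩ := exists_sum_inv_absNorm_le_mul k fun P => ¬ SplitsIn k L P
  simp only [not_not] at h₃
  have hlog : Tendsto (fun N : ℕ => Real.log N) atTop atTop :=
    Real.tendsto_log_atTop.comp tendsto_natCast_atTop_atTop
  obtain ⟨N₀, hN₀⟩ := eventually_atTop.mp
    ((hlog.eventually_ge_atTop (max 1 (2 * C₁ / c₁))).and (eventually_ge_atTop 1))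
  refine ⟨c₁ / 2 / (C₃ * √(3 * C₂)), by positivity, N₀, fun N hN => ?_⟩
  obtain ⟨hl, hN1⟩ := hN₀ N hN
  have hl1 : 1 ≤ Real.log N := (le_max_left _ _).trans hl
  have hl2 : 2 * C₁ ≤ Real.log N * c₁ := (div_le_iff₀ hc₁).mp ((le_max_right _ _).trans hl)
  have e₁ := (h₁ N hN1).trans (h₃ N)
  have e₂ := (sum_split_supported_sq_le k L hdeg N).trans (h₂ (N ^ 2) (Nat.one_le_pow _ _ hN1))
  set W := ∑ m ∈ squarefreeLE k (fun P => ¬ SplitsIn k L P) N, (Ideal.absNorm m : ℝ)⁻¹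
  set B := ∑ b ∈ supportedLE k (SplitsIn k L) N, (Ideal.absNorm b : ℝ)⁻¹
  have hW : 0 ≤ W := sum_nonneg fun _ _ => by positivity
  have e₃ : B ≤ √(3 * C₂) * √(Real.log N) := by
    rw [← Real.sqrt_mul (by positivity)]
    refine Real.le_sqrt_of_sq_le (e₂.trans ?_)
    rw [Nat.cast_pow, Real.log_pow]
    push_cast
    nlinarith
  have hs : 0 < √(Real.log N) := Real.sqrt_pos.mpr (by linarith)
  have e₄ : c₁ / 2 * Real.log N ≤ C₃ * W * (√(3 * C₂) * √(Real.log N)) :=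
    (by linarith : _ ≤ _).trans (e₁.trans (mul_le_mul_of_nonneg_left e₃ (by positivity)))
  rw [div_mul_eq_mul_div, div_le_iff₀ (by positivity)]
  refine le_of_mul_le_mul_right ?_ hs
  calc c₁ / 2 * √(Real.log N) * √(Real.log N) = c₁ / 2 * Real.log N := by
        rw [mul_assoc, Real.mul_self_sqrt (by linarith)]
    _ ≤ _ := e₄
    _ = _ := by ring

end SplitSupported

section Counting

variable {K : Type*} [Field K] [NumberField K] {S : Ideal (𝓞 K) → Prop}

lemma sum_log_absNorm_le_of_dvd {d : Ideal (𝓞 K)} (hd : d ≠ ⊥) (s : Finset (Ideal (𝓞 K)))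
    (hs : ∀ P ∈ s, P.IsPrime ∧ P ≠ ⊥ ∧ P ∣ d) :
    ∑ P ∈ s, Real.log (Ideal.absNorm P) ≤ Real.log (Ideal.absNorm d) := by
  have h : ∏ P ∈ s, P ∣ d := Finset.prod_primes_dvd _
    (fun P hP => Ideal.prime_of_isPrime (hs P hP).2.1 (hs P hP).1) fun P hP => (hs P hP).2.2
  rw [← Real.log_prod fun P hP => (absNorm_cast_pos (hs P hP).2.1).ne', ← Nat.cast_prod,
    ← map_prod]
  refine Real.log_le_log (absNorm_cast_pos (ne_zero_of_dvd_ne_zero hd h)) ?_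
  exact_mod_cast Nat.le_of_dvd (one_le_absNorm hd) (map_dvd Ideal.absNorm h)

open Classical in
lemma sum_squarefreeLE_sum_primes_le (V M : ℕ) :
    ∑ m ∈ squarefreeLE K S M, ∑ P ∈ (primesLE K S (V / Ideal.absNorm m)).filter (¬ · ∣ m),
      Real.log (Ideal.absNorm P) ≤ (squarefreeLE K S V).card * Real.log V := by
  set T := (squarefreeLE K S M).sigma fun m =>
    (primesLE K S (V / Ideal.absNorm m)).filter (¬ · ∣ m) with hT
  have hT' : ∀ z ∈ T, (z.1 ∈ squarefreeLE K S M) ∧ z.2 ∈ primesLE K S (V / Ideal.absNorm z.1) ∧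
      ¬ z.2 ∣ z.1 := by
    intro z hz
    rw [hT, mem_sigma, mem_filter] at hz
    exact hz
  have hmaps : ∀ z ∈ T, z.1 * z.2 ∈ squarefreeLE K S V := by
    intro z hz
    obtain ⟨h1, h2, h3⟩ := hT' z hz
    rw [mem_squarefreeLE] at h1
    rw [mem_primesLE] at h2
    have hp := Ideal.prime_of_isPrime h2.1 h2.2.2.1
    refine mem_squarefreeLE.mpr ⟨mul_ne_zero h1.1 h2.1, ?_, fun P hP hdvd => ?_, ?_⟩
    · rw [map_mul]
      exact (Nat.mul_le_mul_left _ h2.2.1).trans (Nat.mul_div_le _ _)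
    · have hP' := Ideal.prime_of_isPrime (ne_zero_of_dvd_ne_zero (mul_ne_zero h1.1 h2.1) hdvd) hP
      rcases hP'.dvd_mul.mp hdvd with h | h
      · exact h1.2.2.1 P hP h
      · rw [associated_iff_eq.mp (hP'.associated_of_dvd hp h)]
        exact h2.2.2.2
    · rw [mul_comm]
      exact squarefree_mul_iff.mpr ⟨hp.irreducible.isRelPrime_iff_not_dvd.mpr h3,
        hp.irreducible.squarefree, h1.2.2.2⟩
  rw [sum_sigma', ← sum_fiberwise_of_maps_to hmaps, ← nsmul_eq_mul]
  refine sum_le_card_nsmul _ _ _ fun d hd => ?_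
  rw [mem_squarefreeLE] at hd
  have hinj : Set.InjOn (fun z : (_ : Ideal (𝓞 K)) × Ideal (𝓞 K) => z.2)
      ((T.filter fun z => z.1 * z.2 = d : Finset _) : Set ((_ : Ideal (𝓞 K)) × Ideal (𝓞 K))) := by
    rintro ⟨m, P⟩ hz ⟨m', P'⟩ hz' h
    rw [mem_coe, mem_filter] at hz hz'
    simp only at hz hz' h
    subst h
    have h0 : P ≠ 0 := (mem_primesLE.mp (hT' _ hz.1).2.1).1
    rw [mul_right_cancel₀ h0 (hz.2.trans hz'.2.symm)]
  rw [← sum_image (f := fun P => Real.log (Ideal.absNorm P)) hinj]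
  refine (sum_log_absNorm_le_of_dvd hd.1 _ fun P hP => ?_).trans
    (Real.log_le_log (absNorm_cast_pos hd.1) (by exact_mod_cast hd.2.1))
  obtain ⟨z, hz, rfl⟩ := mem_image.mp hP
  rw [mem_filter] at hz
  have h2 := mem_primesLE.mp (hT' z hz.1).2.1
  exact ⟨h2.2.2.1, h2.1, hz.2 ▸ dvd_mul_left _ _⟩

/-- If the primes in `S` have positive lower density, then the number of squarefree ideals
supported on `S` is bounded below in terms of the sum of their inverse norms. -/
lemma le_card_squarefreeLE_of_le_theta {c : ℝ} {N₀ : ℕ} (hN₀ : 1 ≤ N₀)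
    (hθ : ∀ N ≥ N₀, c * N ≤ ∑ P ∈ primesLE K S N, Real.log (Ideal.absNorm P)) (hc : 0 < c)
    (V : ℕ) :
    c / 4 * V * ∑ m ∈ squarefreeLE K S (V / N₀), (Ideal.absNorm m : ℝ)⁻¹ ≤
      (squarefreeLE K S V).card * Real.log V := by
  classical
  set M := V / N₀ with hM
  have hMV : M ≤ V := Nat.div_le_self _ _
  have hlogV : 0 ≤ Real.log V := Real.log_natCast_nonneg V
  have hkey : ∀ m ∈ squarefreeLE K S M, c / 2 * V * (Ideal.absNorm m : ℝ)⁻¹ ≤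
      ∑ P ∈ (primesLE K S (V / Ideal.absNorm m)).filter (¬ · ∣ m), Real.log (Ideal.absNorm P) +
        Real.log V := by
    intro m hm
    rw [mem_squarefreeLE] at hm
    have hm1 := one_le_absNorm hm.1
    have hm0 : (0 : ℝ) < Ideal.absNorm m := absNorm_cast_pos hm.1
    have hle : N₀ ≤ V / Ideal.absNorm m := by
      rw [Nat.le_div_iff_mul_le hm1, mul_comm]
      exact (Nat.le_div_iff_mul_le hN₀).mp hm.2.1
    have h1 := hθ _ hle
    rw [← sum_filter_add_sum_filter_not _ (· ∣ m)] at h1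
    have h2 : ∑ P ∈ (primesLE K S (V / Ideal.absNorm m)).filter (· ∣ m),
        Real.log (Ideal.absNorm P) ≤ Real.log V := by
      refine (sum_log_absNorm_le_of_dvd hm.1 _ fun P hP => ?_).trans
        (Real.log_le_log hm0 (by exact_mod_cast hm.2.1.trans hMV))
      rw [mem_filter, mem_primesLE] at hP
      exact ⟨hP.1.2.2.1, hP.1.1, hP.2⟩
    have h3 : (V : ℝ) * (Ideal.absNorm m : ℝ)⁻¹ ≤ 2 * (V / Ideal.absNorm m : ℕ) := by
      rw [← div_eq_mul_inv, div_le_iff₀ hm0]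
      have h4 : V < Ideal.absNorm m * (V / Ideal.absNorm m + 1) := Nat.lt_mul_div_succ V hm1
      have h5 : V ≤ 2 * (V / Ideal.absNorm m) * Ideal.absNorm m := by nlinarith
      exact_mod_cast h5
    nlinarith [mul_le_mul_of_nonneg_left h3 hc.le]
  have h := sum_le_sum hkey
  rw [← mul_sum, sum_add_distrib, sum_const, nsmul_eq_mul] at h
  have h1 := sum_squarefreeLE_sum_primes_le (S := S) V M
  have h2 : ((squarefreeLE K S M).card : ℝ) * Real.log V ≤
      (squarefreeLE K S V).card * Real.log V := by
    refine mul_le_mul_of_nonneg_right ?_ hlogV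
    exact_mod_cast card_le_card (squarefreeLE_mono hMV)
  linarith

end Counting

section NonsplitCounting

variable (k L : Type*) [Field k] [NumberField k] [Field L] [NumberField L] [Algebra k L]

lemma exists_le_card_squarefree_nonsplit (hdeg : Module.finrank k L = 2) :
    ∃ c : ℝ, 0 < c ∧ ∃ N₀ : ℕ, ∀ N ≥ N₀, c * N ≤
      (squarefreeLE k (fun P => ¬ SplitsIn k L P) N).card * √(Real.log N) := by
  obtain ⟨c₁, hc₁, N₁, h₁⟩ := exists_le_theta_nonsplit k L hdeg
  obtain ⟨c₂, hc₂, N₂, h₂⟩ := exists_le_sum_squarefree_nonsplit k L hdeg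
  set R := max 1 N₁ with hR
  have hR1 : 1 ≤ R := le_max_left _ _
  refine ⟨c₁ / 4 * c₂ / 2, by positivity, max (4 * R ^ 2) (N₂ * R), fun N hN => ?_⟩
  have hN4 : 4 * R ^ 2 ≤ N := (le_max_left _ _).trans hN
  have hN1 : 1 < N := by nlinarith
  have h := le_card_squarefreeLE_of_le_theta hR1
    (fun N hN => h₁ N ((le_max_right _ _).trans hN)) hc₁ N
  have hM := h₂ (N / R) ((Nat.le_div_iff_mul_le hR1).mpr ((le_max_right _ _).trans hN))
  have hl : 0 < Real.log N := Real.log_pos (by exact_mod_cast hN1)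
  have hlog : √(Real.log N) / 2 ≤ √(Real.log (N / R : ℕ)) := by
    have h3 : N ≤ (N / R) ^ 2 := by
      have h4 : N < R * (N / R + 1) := Nat.lt_mul_div_succ N hR1
      have h5 : 4 * R ≤ N / R := (Nat.le_div_iff_mul_le hR1).mpr (by nlinarith)
      nlinarith
    have h4 : Real.log N ≤ 2 * Real.log (N / R : ℕ) := by
      have := Real.log_le_log (by positivity)
        (show (N : ℝ) ≤ ((N / R : ℕ) : ℝ) ^ 2 by exact_mod_cast h3)
      rwa [Real.log_pow, Nat.cast_ofNat] at this
    refine Real.le_sqrt_of_sq_le ?_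
    rw [div_pow, Real.sq_sqrt hl.le]
    linarith
  have hs : 0 < √(Real.log N) := Real.sqrt_pos.mpr hl
  refine le_of_mul_le_mul_right ?_ hs
  calc c₁ / 4 * c₂ / 2 * N * √(Real.log N) = c₁ / 4 * N * (c₂ * (√(Real.log N) / 2)) := by ring
    _ ≤ _ := mul_le_mul_of_nonneg_left ((mul_le_mul_of_nonneg_left hlog hc₂.le).trans hM)
        (by positivity)
    _ ≤ _ := h
    _ = _ := by rw [mul_assoc, Real.mul_self_sqrt hl.le]

end NonsplitCounting

section Parity

variable {K : Type*} [Field K] [NumberField K]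

lemma finite_setOf_prime_dvd {d : Ideal (𝓞 K)} (hd : d ≠ ⊥) :
    {P : Ideal (𝓞 K) | P ≠ ⊥ ∧ P.IsPrime ∧ P ∣ d}.Finite :=
  (idealsLE K (Ideal.absNorm d)).finite_toSet.subset fun _ hP => mem_coe.mpr <|
    mem_idealsLE.mpr ⟨hP.1, Nat.le_of_dvd (one_le_absNorm hd) (map_dvd Ideal.absNorm hP.2.2)⟩

lemma ncard_prime_dvd_mul {p d : Ideal (𝓞 K)} (hp : p.IsPrime) (hp0 : p ≠ ⊥) (hd : d ≠ ⊥)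
    (hpd : ¬ p ∣ d) : {P : Ideal (𝓞 K) | P ≠ ⊥ ∧ P.IsPrime ∧ P ∣ p * d}.ncard =
      {P : Ideal (𝓞 K) | P ≠ ⊥ ∧ P.IsPrime ∧ P ∣ d}.ncard + 1 := by
  rw [← Set.ncard_insert_of_notMem (a := p) (fun h => hpd h.2.2) (finite_setOf_prime_dvd hd)]
  congr 1
  ext P
  simp only [Set.mem_ofPred_eq, Set.mem_insert_iff]
  constructor
  · rintro ⟨h0, hP, hdvd⟩
    have hP' := Ideal.prime_of_isPrime h0 hP
    rcases hP'.dvd_mul.mp hdvd with h | h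
    · exact Or.inl (associated_iff_eq.mp
        (hP'.associated_of_dvd (Ideal.prime_of_isPrime hp0 hp) h))
    · exact Or.inr ⟨h0, hP, h⟩
  · rintro (rfl | ⟨h0, hP, h⟩)
    · exact ⟨hp0, hp, dvd_mul_right _ _⟩
    · exact ⟨h0, hP, h.mul_left _⟩

open Classical in
/-- Toggling a fixed prime `p` shows that both parities of the number of prime divisors occur
with comparable frequency. -/
lemma card_squarefreeLE_le_three_mul {S : Ideal (𝓞 K) → Prop} {p : Ideal (𝓞 K)} (hp : p.IsPrime)
    (hp0 : p ≠ ⊥) (hpS : S p) (M j : ℕ) :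
    (squarefreeLE K S M).card ≤ 3 * ((squarefreeLE K S (Ideal.absNorm p * M)).filter fun d =>
      {P : Ideal (𝓞 K) | P ≠ ⊥ ∧ P.IsPrime ∧ P ∣ d}.ncard % 2 = j % 2).card := by
  set B := (squarefreeLE K S (Ideal.absNorm p * M)).filter fun d =>
      {P : Ideal (𝓞 K) | P ≠ ⊥ ∧ P.IsPrime ∧ P ∣ d}.ncard % 2 = j % 2 with hB
  have hpp := Ideal.prime_of_isPrime hp0 hp
  have hp1 := one_le_absNorm hp0
  set g : Ideal (𝓞 K) → Ideal (𝓞 K) := fun e => if h : p ∣ e then h.choose else e with hg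
  have hg' : ∀ d, g (p * d) = d := by
    intro d
    have h : p ∣ p * d := dvd_mul_right _ _
    rw [hg]
    simp only [h, dif_pos]
    exact (mul_left_cancel₀ hp0 h.choose_spec).symm
  have hsub : squarefreeLE K S M ⊆ B ∪ (B.image (p * ·) ∪ B.image g) := by
    intro d hd
    rw [mem_squarefreeLE] at hd
    obtain ⟨h0, hle, hS, hsq⟩ := hd
    simp only [mem_union, mem_image]
    by_cases hj : {P : Ideal (𝓞 K) | P ≠ ⊥ ∧ P.IsPrime ∧ P ∣ d}.ncard % 2 = j % 2
    · refine Or.inl (mem_filter.mpr ⟨mem_squarefreeLE.mpr ⟨h0, ?_, hS, hsq⟩, hj⟩)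
      nlinarith
    refine Or.inr ?_
    by_cases hpd : p ∣ d
    · obtain ⟨e, rfl⟩ := hpd
      have he0 : e ≠ ⊥ := right_ne_zero_of_mul h0
      have hpe : ¬ p ∣ e := fun ⟨f, hf⟩ =>
        hpp.not_isUnit (hsq p ⟨f, by rw [hf, mul_assoc]⟩)
      refine Or.inl ⟨e, mem_filter.mpr ⟨mem_squarefreeLE.mpr ⟨he0, ?_,
        fun P hP h => hS P hP (h.mul_left _), hsq.of_mul_right⟩, ?_⟩, rfl⟩
      · rw [map_mul] at hle
        nlinarith
      · rw [ncard_prime_dvd_mul hp hp0 he0 hpe] at hj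
        omega
    · refine Or.inr ⟨p * d, mem_filter.mpr ⟨mem_squarefreeLE.mpr ⟨mul_ne_zero hp0 h0, ?_, ?_, ?_⟩,
        ?_⟩, hg' d⟩
      · rw [map_mul]
        exact Nat.mul_le_mul_left _ hle
      · intro P hP h
        have hP' := Ideal.prime_of_isPrime (ne_zero_of_dvd_ne_zero (mul_ne_zero hp0 h0) h) hP
        rcases hP'.dvd_mul.mp h with h | h
        · rw [associated_iff_eq.mp (hP'.associated_of_dvd hpp h)]
          exact hpS
        · exact hS P hP h
      · exact squarefree_mul_iff.mpr ⟨hpp.irreducible.isRelPrime_iff_not_dvd.mpr hpd,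
          hpp.irreducible.squarefree, hsq⟩
      · rw [ncard_prime_dvd_mul hp hp0 h0 hpd]
        omega
  have h1 := card_le_card hsub
  have h2 := card_union_le B (B.image (p * ·) ∪ B.image g)
  have h3 := card_union_le (B.image (p * ·)) (B.image g)
  have h4 := card_image_le (s := B) (f := (p * ·))
  have h5 := card_image_le (s := B) (f := g)
  omega

end Parity

end Auxiliary

/-- Lower bound of order `V·(log V)^{-1/2}` for the number of squarefree ideals `𝔡` of `𝓞 k`
with `|𝔡| ≤ V`, no prime divisor split in the quadratic extension `L/k`, and whose number of
distinct prime divisors is congruent to `n − 1 (mod 2)`, where `n = [k : ℚ]`. -/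
theorem stmt_12 (k L : Type*) [Field k] [NumberField k] [Field L] [NumberField L]
    [Algebra k L] (hdeg : Module.finrank k L = 2) :
    ∃ c : ℝ, 0 < c ∧ ∃ V₀ : ℝ, ∀ V : ℝ, V₀ ≤ V →
      c * V * (Real.log V) ^ (-(1 / 2) : ℝ) ≤
        ({𝔡 : Ideal (𝓞 k) | 𝔡 ≠ ⊥ ∧ Squarefree 𝔡 ∧ (Ideal.absNorm 𝔡 : ℝ) ≤ V ∧
            (∀ P : Ideal (𝓞 k), P.IsPrime → P ∣ 𝔡 → ¬ SplitsIn k L P) ∧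
            {P : Ideal (𝓞 k) | P ≠ ⊥ ∧ P.IsPrime ∧ P ∣ 𝔡}.ncard % 2 =
              (Module.finrank ℚ k - 1) % 2}.ncard : ℝ) := by
  classical
  obtain ⟨c₁, hc₁, N₁, h₁⟩ := exists_le_theta_nonsplit k L hdeg
  obtain ⟨c₂, hc₂, N₂, h₂⟩ := exists_le_card_squarefree_nonsplit k L hdeg
  obtain ⟨p, hp⟩ : (primesLE k (fun P => ¬ SplitsIn k L P) (N₁ + 1)).Nonempty := by
    rw [Finset.nonempty_iff_ne_empty]
    intro h
    have := h₁ (N₁ + 1) (Nat.le_succ _)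
    rw [h, Finset.sum_empty] at this
    push_cast at this
    nlinarith [(Nat.cast_nonneg N₁ : (0 : ℝ) ≤ N₁)]
  obtain ⟨hp0, -, hpP, hpS⟩ := mem_primesLE.mp hp
  have hq := one_le_absNorm hp0
  set q := Ideal.absNorm p with hq'
  have hq0 : (0 : ℝ) < q := by exact_mod_cast hq
  refine ⟨c₂ / (6 * q), by positivity, (q * (N₂ + 2) : ℕ), fun V hV => ?_⟩
  set X := {𝔡 : Ideal (𝓞 k) | 𝔡 ≠ ⊥ ∧ Squarefree 𝔡 ∧ (Ideal.absNorm 𝔡 : ℝ) ≤ V ∧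
    (∀ P : Ideal (𝓞 k), P.IsPrime → P ∣ 𝔡 → ¬ SplitsIn k L P) ∧
    {P : Ideal (𝓞 k) | P ≠ ⊥ ∧ P.IsPrime ∧ P ∣ 𝔡}.ncard % 2 =
      (Module.finrank ℚ k - 1) % 2} with hX
  have hV2 : 2 ≤ V := le_trans (by exact_mod_cast (by nlinarith : 2 ≤ q * (N₂ + 2))) hV
  have hV0 : 0 ≤ V := by linarith
  have hfloor : q * (N₂ + 2) ≤ ⌊V⌋₊ := Nat.le_floor hV
  set M := ⌊V⌋₊ / q with hM
  have hM2 : N₂ + 2 ≤ M := (Nat.le_div_iff_mul_le hq).mpr (by rwa [mul_comm])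
  have hqM : q * M ≤ ⌊V⌋₊ := Nat.mul_div_le _ _
  have hXfin : X.Finite := (idealsLE k ⌊V⌋₊).finite_toSet.subset fun d hd =>
    Finset.mem_coe.mpr (mem_idealsLE.mpr ⟨hd.1, Nat.le_floor hd.2.2.1⟩)
  have hcard : (squarefreeLE k (fun P => ¬ SplitsIn k L P) M).card ≤ 3 * X.ncard := by
    refine (card_squarefreeLE_le_three_mul hpP hp0 hpS M (Module.finrank ℚ k - 1)).trans
      (Nat.mul_le_mul_left _ ?_)
    rw [← Set.ncard_coe_finset]
    refine Set.ncard_le_ncard (fun d hd => ?_) hXfin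
    rw [Finset.mem_coe, Finset.mem_filter, mem_squarefreeLE] at hd
    exact ⟨hd.1.1, hd.1.2.2.2, (Nat.le_floor_iff hV0).mp (hd.1.2.1.trans hqM), hd.1.2.2.1, hd.2⟩
  have hmain := h₂ M (by omega)
  have hMV : (M : ℝ) ≤ V := (Nat.le_floor_iff hV0).mp (Nat.div_le_self _ _)
  have hM0 : (0 : ℝ) < M := by exact_mod_cast (by omega : 0 < M)
  have hVM : V ≤ 2 * q * M := by
    have h3 : ⌊V⌋₊ < q * (M + 1) := Nat.lt_mul_div_succ _ hq
    have h4 : ⌊V⌋₊ + 1 ≤ 2 * q * M := by nlinarith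
    exact (Nat.lt_floor_add_one V).le.trans (by exact_mod_cast h4)
  have hl : 0 < Real.log V := Real.log_pos (by linarith)
  have hs : 0 < √(Real.log V) := Real.sqrt_pos.mpr hl
  rw [Real.rpow_neg hl.le, ← Real.sqrt_eq_rpow, ← div_eq_mul_inv, div_le_iff₀ hs]
  calc c₂ / (6 * q) * V ≤ c₂ / (6 * q) * (2 * q * M) := by gcongr
    _ = c₂ * M / 3 := by field_simp; ring
    _ ≤ (squarefreeLE k (fun P => ¬ SplitsIn k L P) M).card * √(Real.log M) / 3 := by gcongr
    _ ≤ (3 * X.ncard : ℕ) * √(Real.log V) / 3 := by gcongr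
    _ = X.ncard * √(Real.log V) := by push_cast; ring
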